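/- arXiv:2103.01868 — 9 statements merged into one kernel-verified Lean document; each statement's English description precedes it below -/
import Mathlib

section
/- Let α ∈ [0, 1] and let f : [0,1] → [0,1] be a function such that for all x ∈ [0,1], (1 − ∫₀ˣ dx'/f(x')) · f(x) ≤ α. Then ∫₀^{α log(1/α)} dx / f(x) ≥ 1 − α. -/
open MeasureTheory intervalIntegral

/-- A continuous function whose slope to the right satisfies `u z - u x ≤ -(z - x) * (c * u z)`
decays at least exponentially at rate `c`. -/
lemma le_exp_of_sub_le {u : ℝ → ℝ} {c a b : ℝ} (hu : ContinuousOn u (Set.Icc a b))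
    (ha : u a ≤ 1)
    (hstep : ∀ x ∈ Set.Icc a b, ∀ z ∈ Set.Icc a b, x < z → u z - u x ≤ -((z - x) * (c * u z))) :
    ∀ x ∈ Set.Icc a b, u x ≤ Real.exp (-c * (x - a)) := by
  intro x hx
  have key := le_gronwallBound_of_liminf_deriv_right_le (f' := fun x => -c * u x) (δ := 1)
    (K := -c) (ε := 0) hu ?_ ha (fun x _ => by simp) x hx
  · simpa [gronwallBound_ε0] using key
  · intro x hx r hr
    have hIoo : Set.Ioo x b ∈ nhdsWithin x (Set.Ioi x) := Ioo_mem_nhdsGT hx.2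
    have hcont : Filter.Tendsto (fun z => -c * u z) (nhdsWithin x (Set.Ioi x))
        (nhds (-c * u x)) := by
      refine ((hu x ⟨hx.1, hx.2.le⟩).mono_left ?_).const_mul (-c)
      refine nhdsWithin_le_iff.2 (Filter.mem_of_superset hIoo fun z hz => ?_)
      exact ⟨hx.1.trans hz.1.le, hz.2.le⟩
    refine Filter.Eventually.frequently ?_
    filter_upwards [hIoo, hcont.eventually_lt_const hr] with z hz hzr
    have hpos : 0 < z - x := sub_pos.2 hz.1
    have hle := hstep x ⟨hx.1, hx.2.le⟩ z ⟨hx.1.trans hz.1.le, hz.2.le⟩ hz.1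
    refine lt_of_le_of_lt ?_ hzr
    rw [inv_mul_le_iff₀ hpos]
    linarith

/-- Lemma: if `f : [0,1] → (0,1]` satisfies `(1 - ∫₀ˣ dx'/f(x')) f(x) ≤ α` for all
`x ∈ [0,1]`, then `∫₀^{α log(1/α)} dx / f(x) ≥ 1 - α`. -/
theorem stmt0 (α : ℝ) (hα : α ∈ Set.Icc (0:ℝ) 1) (f : ℝ → ℝ)
    (hf : ∀ x ∈ Set.Icc (0:ℝ) 1, f x ∈ Set.Ioc (0:ℝ) 1)
    (hint : IntervalIntegrable (fun x => 1 / f x) volume 0 1)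
    (h : ∀ x ∈ Set.Icc (0:ℝ) 1, (1 - ∫ x' in (0:ℝ)..x, 1 / f x') * f x ≤ α) :
    1 - α ≤ ∫ x in (0:ℝ)..(α * Real.log (1 / α)), 1 / f x := by
  have h01 : (0:ℝ) ∈ Set.Icc (0:ℝ) 1 := ⟨le_rfl, zero_le_one⟩
  have hα0 : 0 < α := by
    have h0 := h 0 h01
    rw [integral_same, sub_zero, one_mul] at h0
    exact (hf 0 h01).1.trans_le h0
  have hsub : ∀ x ∈ Set.Icc (0:ℝ) 1, ∀ z ∈ Set.Icc (0:ℝ) 1,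
      IntervalIntegrable (fun x => 1 / f x) volume x z := fun x hx z hz =>
    hint.mono_set (Set.uIcc_subset_uIcc (by rwa [Set.uIcc_of_le zero_le_one])
      (by rwa [Set.uIcc_of_le zero_le_one]))
  have hadd : ∀ x ∈ Set.Icc (0:ℝ) 1, ∀ z ∈ Set.Icc (0:ℝ) 1,
      (∫ y in (0:ℝ)..x, 1 / f y) + ∫ y in x..z, 1 / f y = ∫ y in (0:ℝ)..z, 1 / f y :=
    fun x hx z hz => integral_add_adjacent_intervals (hsub 0 h01 x hx) (hsub x hx z hz)
  have hmono : ∀ x ∈ Set.Icc (0:ℝ) 1, ∀ z ∈ Set.Icc (0:ℝ) 1, x ≤ z →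
      ∫ y in (0:ℝ)..x, 1 / f y ≤ ∫ y in (0:ℝ)..z, 1 / f y := by
    intro x hx z hz hxz
    have hnonneg : 0 ≤ ∫ y in x..z, 1 / f y := integral_nonneg hxz fun y hy =>
      one_div_nonneg.2 (hf y ⟨hx.1.trans hy.1, hy.2.trans hz.2⟩).1.le
    linarith [hadd x hx z hz]
  have hcont : ContinuousOn (fun x => 1 - ∫ y in (0:ℝ)..x, 1 / f y) (Set.Icc 0 1) := by
    have hprim := continuousOn_primitive_interval (μ := volume) (f := fun x => 1 / f x)
      (a := 0) (b := 1) ((intervalIntegrable_iff' (by simp)).1 hint)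
    rw [Set.uIcc_of_le zero_le_one] at hprim
    exact continuousOn_const.sub hprim
  have hdecay := le_exp_of_sub_le (c := 1 / α) hcont (by simp) <| by
    intro x hx z hz hxz
    have hlow : ∫ _ in x..z, 1 / α * (1 - ∫ y in (0:ℝ)..z, 1 / f y) ≤ ∫ y in x..z, 1 / f y := by
      refine integral_mono_on hxz.le intervalIntegrable_const (hsub x hx z hz) fun y hy => ?_
      have hy' : y ∈ Set.Icc (0:ℝ) 1 := ⟨hx.1.trans hy.1, hy.2.trans hz.2⟩
      have hfy := (hf y hy').1
      have hyz := mul_le_mul_of_nonneg_right (hmono y hy' z hz hy.2) hfy.le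
      rw [one_div_mul_eq_div, div_le_div_iff₀ hα0 hfy]
      linarith [h y hy']
    rw [intervalIntegral.integral_const, smul_eq_mul] at hlow
    linarith [hadd x hx z hz]
  have hlog : Real.log (1 / α) = -Real.log α := by rw [one_div, Real.log_inv]
  have ht : α * Real.log (1 / α) ∈ Set.Icc (0:ℝ) 1 := by
    refine ⟨mul_nonneg hα0.le (Real.log_nonneg ((one_le_div hα0).2 hα.2)), ?_⟩
    have hle := Real.log_le_sub_one_of_pos (one_div_pos.2 hα0)
    calc α * Real.log (1 / α) ≤ α * (1 / α - 1) := mul_le_mul_of_nonneg_left hle hα0.le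
      _ = 1 - α := by field_simp
      _ ≤ 1 := by linarith
  have hfinal := hdecay _ ht
  have hexp : -(1 / α) * (α * Real.log (1 / α) - 0) = Real.log α := by
    rw [hlog]; field_simp; ring
  rw [hexp, Real.exp_log hα0] at hfinal
  linarith
end

section
/- Define ρ : [0,1] → (0,1] by ρ(w) = e^{ew − 1} for w ∈ [0, 1/e] and ρ(w) = 1 for w ∈ [1/e, 1], and define F(x) = ρ(x) · (1 − ∫₀ˣ dx'/ρ(x')). Then F(x) = 1/e for every x ∈ [0, 1/e], and F(x) < 1/e for every x ∈ (1/e, 1]. In particular, max_{x ∈ [0,1]} F(x) = 1/e. -/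
open MeasureTheory intervalIntegral

/-- The rate function `ρ(w) = e^{ew-1}` for `w ≤ 1/e`, and `ρ(w) = 1` afterwards. -/
noncomputable def rho (w : ℝ) : ℝ :=
  if w ≤ 1 / Real.exp 1 then Real.exp (Real.exp 1 * w - 1) else 1

/-- The buyer's utility (per unit of total value) from paying a total fraction `x`
of their value as early as possible in the pay-to-play mechanism with rate `ρ`. -/
noncomputable def F (x : ℝ) : ℝ := rho x * (1 - ∫ x' in (0:ℝ)..x, 1 / rho x')

theorem integral_inv_rho_of_le {x : ℝ} (hx0 : 0 ≤ x) (hx : x ≤ 1 / Real.exp 1) :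
    ∫ t in (0:ℝ)..x, 1 / rho t = 1 - Real.exp (-(Real.exp 1 * x)) := by
  have hcongr : ∫ t in (0:ℝ)..x, 1 / rho t = ∫ t in (0:ℝ)..x, Real.exp (1 - Real.exp 1 * t) := by
    refine integral_congr fun t ht => ?_
    rw [Set.uIcc_of_le hx0] at ht
    simp only [rho, if_pos (ht.2.trans hx)]
    rw [one_div, ← Real.exp_neg, neg_sub]
  have hderiv (t : ℝ) : HasDerivAt (fun s => -Real.exp (-(Real.exp 1 * s)))
      (Real.exp (1 - Real.exp 1 * t)) t := by
    refine (((hasDerivAt_id t).const_mul (Real.exp 1)).neg.exp).neg.congr_deriv ?_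
    rw [sub_eq_add_neg, Real.exp_add]
    simp [mul_comm]
  have hcont : Continuous fun t : ℝ => Real.exp (1 - Real.exp 1 * t) := by fun_prop
  rw [hcongr, integral_eq_sub_of_hasDerivAt (fun t _ => hderiv t) (hcont.intervalIntegrable 0 x)]
  simp
  ring

theorem continuous_rho : Continuous rho := by
  refine Continuous.if_le (by fun_prop) continuous_const continuous_id continuous_const ?_
  rintro w rfl
  simp [(Real.exp_pos 1).ne']

theorem rho_pos (w : ℝ) : 0 < rho w := by
  unfold rho
  split_ifs <;> positivity

theorem F_of_le {x : ℝ} (hx0 : 0 ≤ x) (hx : x ≤ 1 / Real.exp 1) : F x = 1 / Real.exp 1 := by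
  rw [F, integral_inv_rho_of_le hx0 hx, rho, if_pos hx, sub_sub_cancel, ← Real.exp_add, one_div,
    ← Real.exp_neg]
  ring_nf

theorem F_of_gt {x : ℝ} (hx : 1 / Real.exp 1 < x) : F x = 2 / Real.exp 1 - x := by
  have hint (a b : ℝ) : IntervalIntegrable (fun t => 1 / rho t) volume a b :=
    (continuous_const.div continuous_rho fun w => (rho_pos w).ne').intervalIntegrable a b
  have htail : ∫ t in (1 / Real.exp 1)..x, 1 / rho t = x - 1 / Real.exp 1 := by
    have hcongr : ∫ t in (1 / Real.exp 1)..x, 1 / rho t = ∫ _ in (1 / Real.exp 1)..x, (1:ℝ) := by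
      refine integral_congr_ae (Filter.Eventually.of_forall fun t ht => ?_)
      rw [Set.uIoc_of_le hx.le] at ht
      simp only [rho, if_neg ht.1.not_ge, div_one]
    rw [hcongr, intervalIntegral.integral_const, smul_eq_mul, mul_one]
  rw [F, ← integral_add_adjacent_intervals (hint 0 (1 / Real.exp 1)) (hint _ x), htail,
    integral_inv_rho_of_le (by positivity) le_rfl, rho, if_neg hx.not_ge,
    mul_one_div_cancel (Real.exp_pos 1).ne', Real.exp_neg]
  ring

/-- `F(x) = 1/e` on `[0, 1/e]`, `F(x) < 1/e` on `(1/e, 1]`, and the maximum of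
`F` over `[0,1]` is `1/e`. -/
theorem stmt2 :
    (∀ x ∈ Set.Icc (0:ℝ) (1 / Real.exp 1), F x = 1 / Real.exp 1) ∧
    (∀ x ∈ Set.Ioc (1 / Real.exp 1) (1:ℝ), F x < 1 / Real.exp 1) ∧
    IsGreatest (F '' Set.Icc (0:ℝ) 1) (1 / Real.exp 1) := by
  have hgt : ∀ x ∈ Set.Ioc (1 / Real.exp 1) (1:ℝ), F x < 1 / Real.exp 1 := by
    intro x hx
    have h := hx.1
    rw [F_of_gt h]
    linarith [show 2 / Real.exp 1 = 1 / Real.exp 1 + 1 / Real.exp 1 by ring]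
  refine ⟨fun x hx => F_of_le hx.1 hx.2, hgt, ⟨0, by simp, F_of_le le_rfl (by positivity)⟩, ?_⟩
  rintro _ ⟨x, hx, rfl⟩
  rcases le_or_gt x (1 / Real.exp 1) with h | h
  · exact (F_of_le hx.1 h).le
  · exact (hgt x ⟨h, hx.2⟩).le
end

section
/- Define ρ : [0,1] → (0,1] by ρ(w) = e^{ew − 1} for w ∈ [0, 1/e] and ρ(w) = 1 for w ∈ [1/e, 1]. Let V' ≥ V > 0 and define G(x̄) = ρ(x̄) · (V' − V ∫₀^{x̄} dw/ρ(w)). Then G(x̄) = (V' − V)ρ(x̄) + V/e for all x̄ ∈ [0, 1/e], so G is nondecreasing on [0, 1/e] (strictly increasing when V' > V), and G is strictly decreasing on [1/e, 1]. Consequently G attains its maximum over [0,1] at x̄ = 1/e, with G(1/e) = (V' − V) + V/e. -/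
open MeasureTheory intervalIntegral

/-- Utility of a buyer with true total value `V'`, treated as if their total value
were `V`, who front-loads a total payment of `x̄·V`. -/
noncomputable def G (V V' : ℝ) (x : ℝ) : ℝ :=
  rho x * (V' - V * ∫ y in (0:ℝ)..x, 1 / rho y)

lemma rho_eq_exp_min (w : ℝ) : rho w = Real.exp (min (Real.exp 1 * w - 1) 0) := by
  have he := Real.exp_pos 1
  unfold rho
  split_ifs with h
  · rw [le_div_iff₀ he] at h
    rw [min_eq_left (by linarith)]
  · rw [not_le, div_lt_iff₀ he] at h
    rw [min_eq_right (by linarith), Real.exp_zero]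

lemma rho_of_le {w : ℝ} (h : w ≤ 1 / Real.exp 1) :
    rho w = Real.exp (Real.exp 1 * w - 1) := if_pos h

lemma rho_of_ge {w : ℝ} (h : 1 / Real.exp 1 ≤ w) : rho w = 1 := by
  have he := Real.exp_pos 1
  rw [div_le_iff₀ he] at h
  rw [rho_eq_exp_min, min_eq_right (by linarith), Real.exp_zero]

lemma strictMonoOn_rho : StrictMonoOn rho (Set.Iic (1 / Real.exp 1)) := by
  intro x hx y hy hxy
  rw [rho_of_le hx, rho_of_le hy, Real.exp_lt_exp]
  have := mul_lt_mul_of_pos_left hxy (Real.exp_pos 1)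
  linarith

lemma continuous_one_div_rho : Continuous fun w => 1 / rho w := by
  simp only [rho_eq_exp_min]
  exact continuous_const.div (by fun_prop) fun w => (Real.exp_pos _).ne'

lemma integral_one_div_rho_of_le {x : ℝ} (h0 : 0 ≤ x) (h : x ≤ 1 / Real.exp 1) :
    ∫ y in (0:ℝ)..x, 1 / rho y = 1 - Real.exp (-(Real.exp 1 * x)) := by
  have hd : ∀ y ∈ Set.uIcc 0 x,
      HasDerivAt (fun y => -Real.exp (-(Real.exp 1 * y))) (1 / rho y) y := by
    intro y hy
    rw [Set.uIcc_of_le h0] at hy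
    have := (((hasDerivAt_id y).const_mul (Real.exp 1)).fun_neg.exp).fun_neg
    refine this.congr_deriv ?_
    rw [rho_of_le (hy.2.trans h), one_div, ← Real.exp_neg, neg_sub, sub_eq_add_neg, Real.exp_add]
    simp only [id_eq]
    ring
  rw [integral_eq_sub_of_hasDerivAt hd (continuous_one_div_rho.intervalIntegrable _ _)]
  simp
  ring

lemma integral_one_div_rho_of_ge {x : ℝ} (h : 1 / Real.exp 1 ≤ x) :
    ∫ y in (0:ℝ)..x, 1 / rho y = 1 + x - 2 / Real.exp 1 := by
  have he := Real.exp_pos 1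
  have htail : ∫ y in (1 / Real.exp 1)..x, 1 / rho y = x - 1 / Real.exp 1 := by
    rw [integral_congr (g := fun _ => (1 : ℝ))]
    · simp
    · intro y hy
      rw [Set.uIcc_of_le h] at hy
      simp [rho_of_ge hy.1]
  rw [← integral_add_adjacent_intervals (continuous_one_div_rho.intervalIntegrable 0 _)
    (continuous_one_div_rho.intervalIntegrable (1 / Real.exp 1) x), htail,
    integral_one_div_rho_of_le (by positivity) le_rfl, mul_one_div_cancel he.ne', Real.exp_neg]
  ring

lemma G_of_le (V V' : ℝ) {x : ℝ} (h0 : 0 ≤ x) (h : x ≤ 1 / Real.exp 1) :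
    G V V' x = (V' - V) * rho x + V / Real.exp 1 := by
  have hprod : rho x * Real.exp (-(Real.exp 1 * x)) = 1 / Real.exp 1 := by
    rw [rho_of_le h, ← Real.exp_add, one_div, ← Real.exp_neg]
    ring_nf
  rw [G, integral_one_div_rho_of_le h0 h]
  linear_combination V * hprod

lemma G_of_ge (V V' : ℝ) {x : ℝ} (h : 1 / Real.exp 1 ≤ x) :
    G V V' x = V' - V * (1 + x - 2 / Real.exp 1) := by
  rw [G, integral_one_div_rho_of_ge h, rho_of_ge h, one_mul]

/-- For `V' ≥ V > 0`: `G(x̄) = (V'-V)ρ(x̄) + V/e` on `[0,1/e]`, `G` is nondecreasing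
there (strictly increasing if `V' > V`), strictly decreasing on `[1/e, 1]`, and
attains its maximum over `[0,1]` at `x̄ = 1/e` with value `(V'-V) + V/e`. -/
theorem stmt3 (V V' : ℝ) (hV : 0 < V) (hVV' : V ≤ V') :
    (∀ x ∈ Set.Icc (0:ℝ) (1 / Real.exp 1),
      G V V' x = (V' - V) * rho x + V / Real.exp 1) ∧
    MonotoneOn (G V V') (Set.Icc (0:ℝ) (1 / Real.exp 1)) ∧
    (V < V' → StrictMonoOn (G V V') (Set.Icc (0:ℝ) (1 / Real.exp 1))) ∧
    StrictAntiOn (G V V') (Set.Icc (1 / Real.exp 1) 1) ∧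
    IsGreatest (G V V' '' Set.Icc (0:ℝ) 1) (G V V' (1 / Real.exp 1)) ∧
    G V V' (1 / Real.exp 1) = (V' - V) + V / Real.exp 1 := by
  have he : 0 ≤ 1 / Real.exp 1 := by positivity
  have he1 : 1 / Real.exp 1 ≤ 1 := by
    rw [div_le_one (Real.exp_pos 1)]
    exact Real.one_le_exp zero_le_one
  have hmono : MonotoneOn (G V V') (Set.Icc (0:ℝ) (1 / Real.exp 1)) := by
    intro x hx y hy hxy
    rw [G_of_le V V' hx.1 hx.2, G_of_le V V' hy.1 hy.2]
    have := strictMonoOn_rho.monotoneOn hx.2 hy.2 hxy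
    have := mul_le_mul_of_nonneg_left this (sub_nonneg.2 hVV')
    linarith
  have hanti : StrictAntiOn (G V V') (Set.Icc (1 / Real.exp 1) 1) := by
    intro x hx y hy hxy
    rw [G_of_ge V V' hx.1, G_of_ge V V' hy.1]
    have := mul_lt_mul_of_pos_left hxy hV
    linarith
  refine ⟨fun x hx => G_of_le V V' hx.1 hx.2, hmono, ?_, hanti, ⟨⟨_, ⟨he, he1⟩, rfl⟩, ?_⟩, ?_⟩
  · intro hlt x hx y hy hxy
    rw [G_of_le V V' hx.1 hx.2, G_of_le V V' hy.1 hy.2]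
    have := strictMonoOn_rho hx.2 hy.2 hxy
    have := mul_lt_mul_of_pos_left this (sub_pos.2 hlt)
    linarith
  · rintro _ ⟨x, hx, rfl⟩
    rcases le_total x (1 / Real.exp 1) with h | h
    · exact hmono ⟨hx.1, h⟩ ⟨he, le_rfl⟩ h
    · exact hanti.antitoneOn ⟨le_rfl, he1⟩ ⟨h, hx.2⟩ h
  · rw [G_of_le V V' he le_rfl, rho_of_ge le_rfl, mul_one]
end

section
/- Fix a truthful continuous single-buyer mechanism defined on all types v with ∫₀¹ v(t) dt = 1, and let M = inf_v X_v over such types. Suppose α ∈ (0,1] is such that U_v ≤ α for all types v. Then U_v ≤ α log(1/α) + α − M for all types v. -/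
open MeasureTheory intervalIntegral

/-- A type in the continuous single-buyer game with total value `V`: a
Lipschitz-continuous nonnegative value function `v : [0,1] → [0,∞)` with
`∫₀¹ v(t) dt = V`. -/
def IsCType (V : ℝ) (v : ℝ → ℝ) : Prop :=
  (∃ K : NNReal, LipschitzOnWith K v (Set.Icc (0:ℝ) 1)) ∧
  (∀ t ∈ Set.Icc (0:ℝ) 1, 0 ≤ v t) ∧
  (∫ t in (0:ℝ)..1, v t) = V

/-- A truthful continuous single-buyer mechanism `(r, x)` on the domain of all
types of total value `V`: continuous rates in `[0,1]`, continuous nonnegative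
payments, per-time individual rationality, and dynamic incentive compatibility. -/
def CTruthful (V : ℝ) (r x : (ℝ → ℝ) → ℝ → ℝ) : Prop :=
  (∀ v, IsCType V v →
    ContinuousOn (r v) (Set.Icc (0:ℝ) 1) ∧ ContinuousOn (x v) (Set.Icc (0:ℝ) 1) ∧
    (∀ t ∈ Set.Icc (0:ℝ) 1,
      r v t ∈ Set.Icc (0:ℝ) 1 ∧ 0 ≤ x v t ∧ 0 ≤ r v t * v t - x v t)) ∧
  (∀ v v', IsCType V v → IsCType V v' → ∀ τ ∈ Set.Icc (0:ℝ) 1,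
    (∀ t ∈ Set.Icc (0:ℝ) τ, 0 ≤ r v' t * v t - x v' t) →
    (∫ t in (0:ℝ)..1, (r v t * v t - x v t)) ≥
      ∫ t in (0:ℝ)..τ, (r v' t * v t - x v' t))

theorem LipschitzOnWith.exists_mul_of_bounded {f g : ℝ → ℝ} {s : Set ℝ} {K L : NNReal} {A B : ℝ}
    (hf : LipschitzOnWith K f s) (hg : LipschitzOnWith L g s)
    (hA : ∀ t ∈ s, |f t| ≤ A) (hB : ∀ t ∈ s, |g t| ≤ B) :
    ∃ C : NNReal, LipschitzOnWith C (fun t => f t * g t) s := by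
  refine ⟨Real.toNNReal (A * L + B * K), LipschitzOnWith.of_dist_le_mul fun p hp q hq => ?_⟩
  have h1 := hf.dist_le_mul p hp q hq
  have h2 := hg.dist_le_mul p hp q hq
  rw [Real.dist_eq] at h1 h2 ⊢
  have hAp := hA p hp
  have hBq := hB q hq
  have hd : (0 : ℝ) ≤ dist p q := dist_nonneg
  calc |f p * g p - f q * g q| = |f p * (g p - g q) + g q * (f p - f q)| := by ring_nf
    _ ≤ |f p| * |g p - g q| + |g q| * |f p - f q| := by
        simpa only [abs_mul] using abs_add_le (f p * (g p - g q)) (g q * (f p - f q))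
    _ ≤ A * (L * dist p q) + B * (K * dist p q) := by
        gcongr
        · exact (abs_nonneg _).trans hAp
        · exact (abs_nonneg _).trans hBq
    _ = (A * L + B * K) * dist p q := by ring
    _ ≤ _ := by
        gcongr
        exact Real.le_coe_toNNReal _

/-- The ramp equal to `1` before `m`, to `0` after `b`, and linear in between. -/
noncomputable def ramp (m b t : ℝ) : ℝ := min 1 (max 0 ((b - t) / (b - m)))

theorem ramp_nonneg (m b t : ℝ) : 0 ≤ ramp m b t := le_min zero_le_one (le_max_left _ _)

theorem ramp_le_one (m b t : ℝ) : ramp m b t ≤ 1 := min_le_left _ _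

theorem ramp_eq_one {m b t : ℝ} (hmb : m < b) (ht : t ≤ m) : ramp m b t = 1 := by
  have : 1 ≤ (b - t) / (b - m) := by rw [le_div_iff₀ (by linarith)]; linarith
  exact min_eq_left (this.trans (le_max_right _ _))

theorem ramp_eq_zero {m b t : ℝ} (hmb : m < b) (ht : b ≤ t) : ramp m b t = 0 := by
  have : (b - t) / (b - m) ≤ 0 := div_nonpos_of_nonpos_of_nonneg (by linarith) (by linarith)
  simp [ramp, max_eq_left this]

theorem exists_lipschitzWith_ramp (m b : ℝ) : ∃ K : NNReal, LipschitzWith K (ramp m b) := by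
  refine ⟨‖(b - m)⁻¹‖₊, LipschitzWith.const_min (LipschitzWith.const_max ?_ 0) 1⟩
  refine LipschitzWith.of_dist_le_mul fun p q => le_of_eq ?_
  rw [Real.dist_eq, Real.dist_eq, coe_nnnorm, Real.norm_eq_abs, ← abs_mul, abs_sub_comm]
  congr 1
  ring

/-- The quadratic bump supported on `[a, m]`. -/
noncomputable def bump (a m t : ℝ) : ℝ := max 0 ((t - a) * (m - t))

theorem bump_nonneg (a m t : ℝ) : 0 ≤ bump a m t := le_max_left _ _

theorem bump_eq_zero {a m t : ℝ} (h : t ≤ a ∧ a ≤ m ∨ a ≤ m ∧ m ≤ t) : bump a m t = 0 := by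
  refine max_eq_left ?_
  rcases h with ⟨h1, h2⟩ | ⟨h1, h2⟩
  · exact mul_nonpos_of_nonpos_of_nonneg (by linarith) (by linarith)
  · exact mul_nonpos_of_nonneg_of_nonpos (by linarith) (by linarith)

theorem continuous_bump (a m : ℝ) : Continuous (bump a m) := by
  unfold bump; fun_prop

theorem exists_lipschitzOnWith_bump (a m : ℝ) :
    ∃ K : NNReal, LipschitzOnWith K (bump a m) (Set.Icc 0 1) := by
  have hf : LipschitzOnWith 1 (fun t : ℝ => t - a) (Set.Icc 0 1) :=
    LipschitzOnWith.of_dist_le_mul fun p _ q _ => by simp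
  have hg : LipschitzOnWith 1 (fun t : ℝ => m - t) (Set.Icc 0 1) :=
    LipschitzOnWith.of_dist_le_mul fun p _ q _ => by rw [dist_sub_left]; simp
  have hb (c : ℝ) : ∀ t ∈ Set.Icc (0 : ℝ) 1, |t - c| ≤ 1 + |c| := fun t ht =>
    (abs_sub t c).trans (by gcongr; exact abs_le.2 ⟨by linarith [ht.1], ht.2⟩)
  obtain ⟨C, hC⟩ := hf.exists_mul_of_bounded hg (hb a)
    (fun t ht => (abs_sub_comm m t).le.trans (hb m t ht))
  exact ⟨1 * C, (LipschitzWith.id.const_max 0).comp_lipschitzOnWith hC⟩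

theorem integral_bump_pos {a m : ℝ} (ha : 0 ≤ a) (ham : a < m) :
    0 < ∫ t in (0 : ℝ)..m, bump a m t := by
  refine intervalIntegral.integral_pos (ha.trans_lt ham) (continuous_bump a m).continuousOn
    (fun t _ => bump_nonneg a m t) ⟨(a + m) / 2, ⟨by linarith, by linarith⟩, ?_⟩
  exact lt_max_of_lt_right (mul_pos (by linarith) (by linarith))

theorem IsCType.continuousOn {V : ℝ} {v : ℝ → ℝ} (hv : IsCType V v) :
    ContinuousOn v (Set.Icc 0 1) := by
  obtain ⟨⟨K, hK⟩, -⟩ := hv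
  exact hK.continuousOn

theorem ContinuousOn.intervalIntegrable_of_subset_unit {f : ℝ → ℝ}
    (hf : ContinuousOn f (Set.Icc 0 1)) {a b : ℝ} (ha : 0 ≤ a) (hab : a ≤ b) (hb : b ≤ 1) :
    IntervalIntegrable f volume a b :=
  (hf.mono (Set.Icc_subset_Icc ha hb)).intervalIntegrable_of_Icc hab

/-- The value `v` can be kept up to time `m`, cut off after `b`, and the remaining mass moved
into a bump on `[a, m]`. -/
theorem IsCType.exists_concentrate {v : ℝ → ℝ} (hv : IsCType 1 v) {a m b : ℝ} (ha : 0 ≤ a)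
    (ham : a < m) (hmb : m < b) (hb : b ≤ 1) :
    ∃ c : ℝ, 0 ≤ c ∧ IsCType 1 (fun t => ramp m b t * v t + c * bump a m t) ∧
      1 - ∫ t in (0 : ℝ)..b, v t ≤ c * ∫ t in (0 : ℝ)..m, bump a m t := by
  have hvc := hv.continuousOn
  obtain ⟨⟨K, hK⟩, hv0, hv1⟩ := hv
  obtain ⟨L, hL⟩ := exists_lipschitzWith_ramp m b
  have hφv : ContinuousOn (fun t => ramp m b t * v t) (Set.Icc 0 1) :=
    hL.continuous.continuousOn.mul hvc
  have hle : ∀ t ∈ Set.Icc (0 : ℝ) 1, ramp m b t * v t ≤ v t := fun t ht =>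
    mul_le_of_le_one_left (hv0 t ht) (ramp_le_one m b t)
  have hb0 : 0 ≤ b := by linarith
  have hcut : ∫ t in (0 : ℝ)..1, ramp m b t * v t ≤ ∫ t in (0 : ℝ)..b, v t := by
    rw [← integral_add_adjacent_intervals
      (hφv.intervalIntegrable_of_subset_unit le_rfl hb0 hb)
      (hφv.intervalIntegrable_of_subset_unit hb0 hb le_rfl)]
    have htail : ∫ t in b..1, ramp m b t * v t = 0 := by
      rw [integral_congr (g := fun _ => (0 : ℝ)), intervalIntegral.integral_zero]
      intro t ht
      rw [Set.uIcc_of_le hb] at ht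
      simp [ramp_eq_zero hmb ht.1]
    rw [htail, add_zero]
    exact integral_mono_on hb0 (hφv.intervalIntegrable_of_subset_unit le_rfl hb0 hb)
      (hvc.intervalIntegrable_of_subset_unit le_rfl hb0 hb)
      fun t ht => hle t ⟨ht.1, ht.2.trans hb⟩
  have hle1 : ∫ t in (0 : ℝ)..1, ramp m b t * v t ≤ 1 := by
    refine le_trans ?_ hv1.le
    exact integral_mono_on zero_le_one
      (hφv.intervalIntegrable_of_subset_unit le_rfl zero_le_one le_rfl)
      (hvc.intervalIntegrable_of_subset_unit le_rfl zero_le_one le_rfl) hle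
  have hpos := integral_bump_pos ha ham
  have hbump : ∫ t in (0 : ℝ)..1, bump a m t = ∫ t in (0 : ℝ)..m, bump a m t := by
    rw [← integral_add_adjacent_intervals (b := m)
      ((continuous_bump a m).intervalIntegrable _ _) ((continuous_bump a m).intervalIntegrable _ _)]
    have htail : ∫ t in m..1, bump a m t = 0 := by
      rw [integral_congr (g := fun _ => (0 : ℝ)), intervalIntegral.integral_zero]
      intro t ht
      rw [Set.uIcc_of_le (by linarith)] at ht
      simp [bump_eq_zero (Or.inr ⟨ham.le, ht.1⟩)]
    rw [htail, add_zero]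
  have hc0 : 0 ≤ (1 - ∫ t in (0 : ℝ)..1, ramp m b t * v t) / ∫ t in (0 : ℝ)..m, bump a m t :=
    div_nonneg (by linarith) hpos.le
  have hcm : ((1 - ∫ t in (0 : ℝ)..1, ramp m b t * v t) / ∫ t in (0 : ℝ)..m, bump a m t) *
      ∫ t in (0 : ℝ)..m, bump a m t = 1 - ∫ t in (0 : ℝ)..1, ramp m b t * v t :=
    div_mul_cancel₀ _ hpos.ne'
  generalize (1 - ∫ t in (0 : ℝ)..1, ramp m b t * v t) /
    (∫ t in (0 : ℝ)..m, bump a m t) = c at hc0 hcm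
  refine ⟨c, hc0, ⟨?_, fun t ht => ?_, ?_⟩, by linarith⟩
  · obtain ⟨B, hB⟩ := isCompact_Icc.exists_bound_of_continuousOn hvc
    obtain ⟨C, hC⟩ := hL.lipschitzOnWith.exists_mul_of_bounded hK
      (fun t _ => (abs_of_nonneg (ramp_nonneg m b t)).le.trans (ramp_le_one m b t)) hB
    obtain ⟨D, hD⟩ := exists_lipschitzOnWith_bump a m
    exact ⟨C + ‖c‖₊ * D, hC.add
      ((lipschitzWith_smul c).comp_lipschitzOnWith hD)⟩
  · exact add_nonneg (mul_nonneg (ramp_nonneg m b t) (hv0 t ht))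
      (mul_nonneg hc0 (bump_nonneg a m t))
  · rw [intervalIntegral.integral_add
      (hφv.intervalIntegrable_of_subset_unit le_rfl zero_le_one le_rfl)
      (((continuous_bump a m).intervalIntegrable _ _).const_mul c),
      intervalIntegral.integral_const_mul, hbump, hcm]
    ring

/-- Deviation bound: a type that follows `v` and concentrates its remaining value on `[a, m]`
can imitate `v` until time `m`. -/
theorem CTruthful.mul_one_sub_integral_le {r x : (ℝ → ℝ) → ℝ → ℝ} (h : CTruthful 1 r x) {α : ℝ}
    (hU : ∀ v, IsCType 1 v → (∫ t in (0 : ℝ)..1, (r v t * v t - x v t)) ≤ α)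
    {v : ℝ → ℝ} (hv : IsCType 1 v) {a m b : ℝ} (ha : 0 ≤ a) (ham : a < m) (hmb : m < b)
    (hb : b ≤ 1) {l : ℝ} (hl0 : 0 ≤ l) (hl : ∀ t ∈ Set.Icc a m, l ≤ r v t) :
    l * (1 - ∫ t in (0 : ℝ)..b, v t) ≤ α := by
  obtain ⟨c, hc0, hw, hc⟩ := hv.exists_concentrate ha ham hmb hb
  obtain ⟨hr, hx, hir⟩ := h.1 v hv
  have hm0 : 0 ≤ m := by linarith
  have hm1 : m ≤ 1 := by linarith
  have hpt : ∀ t ∈ Set.Icc (0 : ℝ) m,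
      l * c * bump a m t ≤ r v t * (ramp m b t * v t + c * bump a m t) - x v t := by
    intro t ht
    obtain ⟨-, -, hu⟩ := hir t ⟨ht.1, ht.2.trans hm1⟩
    rw [ramp_eq_one hmb ht.2, one_mul]
    have hlr : l * (c * bump a m t) ≤ r v t * (c * bump a m t) := by
      rcases le_total t a with hta | hta
      · simp [bump_eq_zero (Or.inl ⟨hta, ham.le⟩)]
      · exact mul_le_mul_of_nonneg_right (hl t ⟨hta, ht.2⟩)
          (mul_nonneg hc0 (bump_nonneg a m t))
    linarith
  have hdev := h.2 _ v hw hv m ⟨hm0, hm1⟩ fun t ht =>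
    (mul_nonneg (mul_nonneg hl0 hc0) (bump_nonneg a m t)).trans (hpt t ht)
  calc l * (1 - ∫ t in (0 : ℝ)..b, v t) ≤ l * (c * ∫ t in (0 : ℝ)..m, bump a m t) := by gcongr
    _ = ∫ t in (0 : ℝ)..m, l * c * bump a m t := by
        rw [intervalIntegral.integral_const_mul, mul_assoc]
    _ ≤ ∫ t in (0 : ℝ)..m, (r v t * (ramp m b t * v t + c * bump a m t) - x v t) :=
        integral_mono_on hm0 (((continuous_bump a m).intervalIntegrable _ _).const_mul _)
          (((hr.mul hw.continuousOn).sub hx).intervalIntegrable_of_subset_unit le_rfl hm0 hm1) hpt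
    _ ≤ _ := hdev
    _ ≤ α := hU _ hw

theorem IsCType.continuousOn_integral {V : ℝ} {v : ℝ → ℝ} (hv : IsCType V v) :
    ContinuousOn (fun t => ∫ s in (0 : ℝ)..t, v s) (Set.Icc 0 1) := by
  have := continuousOn_primitive_interval (μ := volume) (f := v) (a := 0) (b := 1)
    (by rw [Set.uIcc_of_le zero_le_one]; exact hv.continuousOn.integrableOn_Icc)
  rwa [Set.uIcc_of_le zero_le_one] at this

/-- The rate offered at time `τ` is at most `α` divided by the value still to come. -/
theorem CTruthful.rate_mul_le {r x : (ℝ → ℝ) → ℝ → ℝ} (h : CTruthful 1 r x) {α : ℝ}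
    (hα : 0 ≤ α)
    (hU : ∀ v, IsCType 1 v → (∫ t in (0 : ℝ)..1, (r v t * v t - x v t)) ≤ α)
    {v : ℝ → ℝ} (hv : IsCType 1 v) {τ : ℝ} (hτ : τ ∈ Set.Icc (0 : ℝ) 1) :
    r v τ * (1 - ∫ t in (0 : ℝ)..τ, v t) ≤ α := by
  rcases hτ.2.eq_or_lt with rfl | hτ1
  · rw [hv.2.2]; simpa using hα
  by_contra! hlt
  obtain ⟨hr, -, hir⟩ := h.1 v hv
  have hF : Filter.Tendsto (fun p : ℝ × ℝ => r v p.1 * (1 - ∫ t in (0 : ℝ)..p.2, v t))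
      (nhdsWithin τ (Set.Icc 0 1) ×ˢ nhdsWithin τ (Set.Icc 0 1))
      (nhds (r v τ * (1 - ∫ t in (0 : ℝ)..τ, v t))) :=
    ((hr τ hτ).tendsto.comp Filter.tendsto_fst).mul
      (((hv.continuousOn_integral τ hτ).tendsto.comp Filter.tendsto_snd).const_sub 1)
  obtain ⟨S, hS, hS'⟩ := Filter.eventually_prod_self_iff'.1 (hF.eventually_const_lt hlt)
  obtain ⟨ε, hε, hball⟩ := Metric.mem_nhdsWithin_iff.1 hS
  obtain ⟨b, hb1, hb2⟩ := exists_between (lt_min hτ1 (lt_add_of_pos_right τ hε))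
  obtain ⟨m, hm1, hm2⟩ := exists_between hb1
  have hbl := hb2.trans_le (min_le_left _ _)
  have hbr := hb2.trans_le (min_le_right _ _)
  have hmem : ∀ t ∈ Set.Icc τ b, t ∈ S := fun t ht => hball
    ⟨by rw [Metric.mem_ball, Real.dist_eq, abs_lt]; constructor <;> linarith [ht.1, ht.2],
      hτ.1.trans ht.1, ht.2.trans hbl.le⟩
  obtain ⟨s, hs, hmin⟩ := isCompact_Icc.exists_isMinOn (Set.nonempty_Icc.2 hm1.le)
    (hr.mono (Set.Icc_subset_Icc hτ.1 (hm2.trans hbl).le))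
  have hge := hS' s (hmem s ⟨hs.1, hs.2.trans hm2.le⟩) b (hmem b ⟨hb1.le, le_rfl⟩)
  have hle := h.mul_one_sub_integral_le hU hv hτ.1 hm1 hm2 hbl.le
    (hir s ⟨hτ.1.trans hs.1, hs.2.trans (hm2.trans hbl).le⟩).1.1 fun t ht => hmin ht
  exact absurd hle (not_le.2 hge)

theorem integral_div_max_one_sub {α : ℝ} (h0 : 0 < α) (h1 : α ≤ 1) :
    ∫ s in (0 : ℝ)..1, α / max α (1 - s) = α * Real.log (1 / α) + α := by
  have hc : Continuous fun s : ℝ => α / max α (1 - s) :=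
    continuous_const.div (by fun_prop) fun s => (lt_max_of_lt_left h0).ne'
  rw [← integral_add_adjacent_intervals (b := 1 - α) (hc.intervalIntegrable _ _)
    (hc.intervalIntegrable _ _)]
  congr 1
  · rw [integral_congr (g := fun s => α * (1 - s)⁻¹), intervalIntegral.integral_const_mul,
      intervalIntegral.integral_comp_sub_left (fun s : ℝ => s⁻¹) 1]
    · rw [sub_sub_cancel, sub_zero, integral_inv_of_pos h0 one_pos]
    · intro s hs
      rw [Set.uIcc_of_le (by linarith)] at hs
      simp only [div_eq_mul_inv]
      rw [max_eq_right (by linarith [hs.2])]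
  · rw [integral_congr (g := fun _ => (1 : ℝ))]
    · simp
    · intro s hs
      rw [Set.uIcc_of_le (by linarith)] at hs
      simp only
      rw [max_eq_left (by linarith [hs.1]), div_self h0.ne']

theorem CTruthful.welfare_le {r x : (ℝ → ℝ) → ℝ → ℝ} (h : CTruthful 1 r x) {α : ℝ}
    (hα : α ∈ Set.Ioc (0 : ℝ) 1)
    (hU : ∀ v, IsCType 1 v → (∫ t in (0 : ℝ)..1, (r v t * v t - x v t)) ≤ α)
    {v : ℝ → ℝ} (hv : IsCType 1 v) :
    ∫ t in (0 : ℝ)..1, r v t * v t ≤ α * Real.log (1 / α) + α := by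
  obtain ⟨hr, -, hir⟩ := h.1 v hv
  have hvc := hv.continuousOn
  have hVc := hv.continuousOn_integral
  have hg : Continuous fun s : ℝ => α / max α (1 - s) :=
    continuous_const.div (by fun_prop) fun s => (lt_max_of_lt_left hα.1).ne'
  have hsub : ∫ t in (0 : ℝ)..1, α / max α (1 - ∫ s in (0 : ℝ)..t, v s) * v t =
      ∫ s in (0 : ℝ)..1, α / max α (1 - s) := by
    have hcv := integral_comp_mul_deriv'' (a := 0) (b := 1) (f' := v)
      (g := fun s : ℝ => α / max α (1 - s)) (f := fun t => ∫ s in (0 : ℝ)..t, v s)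
      (by rwa [Set.uIcc_of_le zero_le_one]) (fun t ht => ?_)
      (by rwa [Set.uIcc_of_le zero_le_one]) hg.continuousOn
    · simpa [hv.2.2] using hcv
    · rw [min_eq_left zero_le_one, max_eq_right zero_le_one] at ht
      exact (integral_hasDerivAt_right
        (hvc.intervalIntegrable_of_subset_unit le_rfl ht.1.le ht.2.le)
        ((hvc.mono Set.Ioo_subset_Icc_self).stronglyMeasurableAtFilter isOpen_Ioo t ht)
        (hvc.continuousAt (Icc_mem_nhds ht.1 ht.2))).hasDerivWithinAt
  rw [← integral_div_max_one_sub hα.1 hα.2, ← hsub]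
  refine integral_mono_on zero_le_one
    ((hr.mul hvc).intervalIntegrable_of_subset_unit le_rfl zero_le_one le_rfl)
    (((hg.comp_continuousOn hVc).mul hvc).intervalIntegrable_of_subset_unit le_rfl zero_le_one
      le_rfl) fun t ht => ?_
  refine mul_le_mul_of_nonneg_right ?_ (hv.2.1 t ht)
  rw [le_div_iff₀ (lt_max_of_lt_left hα.1)]
  rcases max_choice α (1 - ∫ s in (0 : ℝ)..t, v s) with hmax | hmax <;> rw [hmax]
  · exact mul_le_of_le_one_left hα.1.le (hir t ht).1.2
  · exact h.rate_mul_le hα.1.le hU hv ht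

/-- Recursive utility bound: if every type's utility is at most `α ∈ (0,1]`, then
every type's utility is at most `α log(1/α) + α − M`, where `M` is the
worst-case revenue of the mechanism. -/
theorem stmt5 (r x : (ℝ → ℝ) → ℝ → ℝ) (h : CTruthful 1 r x)
    (α : ℝ) (hα : α ∈ Set.Ioc (0:ℝ) 1)
    (M : ℝ) (hM : M = sInf {X : ℝ | ∃ v, IsCType 1 v ∧ X = ∫ t in (0:ℝ)..1, x v t})
    (hU : ∀ v, IsCType 1 v →
      (∫ t in (0:ℝ)..1, (r v t * v t - x v t)) ≤ α) :
    ∀ v, IsCType 1 v →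
      (∫ t in (0:ℝ)..1, (r v t * v t - x v t)) ≤ α * Real.log (1 / α) + α - M := by
  intro v hv
  obtain ⟨hr, hx, -⟩ := h.1 v hv
  have hMle : M ≤ ∫ t in (0 : ℝ)..1, x v t := by
    rw [hM]
    refine csInf_le ⟨0, ?_⟩ ⟨v, hv, rfl⟩
    rintro _ ⟨w, hw, rfl⟩
    exact integral_nonneg zero_le_one fun t ht => ((h.1 w hw).2.2 t ht).2.1
  have hrv : ContinuousOn (fun t => r v t * v t) (Set.Icc 0 1) := hr.mul hv.continuousOn
  rw [intervalIntegral.integral_sub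
    (hrv.intervalIntegrable_of_subset_unit le_rfl zero_le_one le_rfl)
    (hx.intervalIntegrable_of_subset_unit le_rfl zero_le_one le_rfl)]
  linarith [h.welfare_le hα hU hv]
end

section
/- There is an absolute constant C such that for every real V ≥ 1 and every T ∈ ℕ, there exists a truthful discrete single-buyer mechanism over T rounds, defined on all types v ∈ [0,1]^T with Σ_{t=1}^T v_t = V, whose revenue satisfies Rev(v) ≥ V/e − C for every such type v, and whose reimbursements satisfy g_v ≤ C for every such type v. -/
open Finset

/-- A discrete type over `T` rounds (1-indexed): values in `[0,1]` each round. -/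
def IsDType (T : ℕ) (v : ℕ → ℝ) : Prop :=
  ∀ t ∈ Finset.Icc 1 T, v t ∈ Set.Icc (0:ℝ) 1

/-- A truthful discrete single-buyer mechanism `(r, x, g)` over `T` rounds, defined
on all types of total value `V`: allocations in `[0,1]`, nonnegative payments and
reimbursement, limited liability, and dynamic incentive compatibility. -/
def DTruthfulG (T : ℕ) (V : ℝ) (r x : (ℕ → ℝ) → ℕ → ℝ) (g : (ℕ → ℝ) → ℝ) : Prop :=
  (∀ v, IsDType T v → (∑ t ∈ Finset.Icc 1 T, v t) = V →
    (∀ t ∈ Finset.Icc 1 T,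
      r v t ∈ Set.Icc (0:ℝ) 1 ∧ 0 ≤ x v t ∧ x v t ≤ r v t * v t) ∧ 0 ≤ g v) ∧
  (∀ v v', IsDType T v → IsDType T v' →
    (∑ t ∈ Finset.Icc 1 T, v t) = V → (∑ t ∈ Finset.Icc 1 T, v' t) = V →
    ∀ τ ∈ Finset.Icc 1 T,
      (∀ t ∈ Finset.Icc 1 τ, x v' t ≤ r v' t * v t) →
      (∑ t ∈ Finset.Icc 1 T, (r v t * v t - x v t)) + g v ≥
        (∑ t ∈ Finset.Icc 1 τ, (r v' t * v t - x v' t)) + x v' τ)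

/-- Total value reported in rounds `1, …, n`. -/
noncomputable def cumValue (v : ℕ → ℝ) (n : ℕ) : ℝ := ∑ t ∈ Finset.Icc 1 n, v t

/-- Allocation after cumulative reported value `a`: `u / (V - a)`, capped at `1`. -/
noncomputable def allocRate (V u a : ℝ) : ℝ := u / max u (V - a)

/-- Allocation in round `t`, determined by the value reported before round `t`. -/
noncomputable def dAlloc (V u : ℝ) (v : ℕ → ℝ) (t : ℕ) : ℝ :=
  allocRate V u (cumValue v (t - 1))

/-- Payment in round `t`: the full value of the allocation until cumulative value `V - u` is
reached, and nothing afterwards. -/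
noncomputable def dPay (V u : ℝ) (v : ℕ → ℝ) (t : ℕ) : ℝ :=
  if cumValue v (t - 1) < V - u then dAlloc V u v t * v t else 0

lemma cumValue_zero (v : ℕ → ℝ) : cumValue v 0 = 0 := by simp [cumValue]

lemma cumValue_succ (v : ℕ → ℝ) (n : ℕ) : cumValue v (n + 1) = cumValue v n + v (n + 1) :=
  Finset.sum_Icc_succ_top (by omega) v

lemma cumValue_le_of_le {T : ℕ} {v : ℕ → ℝ} (hv : IsDType T v) {n : ℕ} (hn : n ≤ T) :
    cumValue v n ≤ cumValue v T :=
  Finset.sum_le_sum_of_subset_of_nonneg (Finset.Icc_subset_Icc_right hn)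
    fun t ht _ => (hv t ht).1

lemma IsDType.succ_mem {T : ℕ} {v : ℕ → ℝ} (hv : IsDType T v) {n : ℕ} (hn : n + 1 ≤ T) :
    0 ≤ v (n + 1) ∧ v (n + 1) ≤ 1 :=
  hv (n + 1) (Finset.mem_Icc.2 ⟨by omega, hn⟩)

lemma allocRate_pos {V u : ℝ} (hu : 0 < u) (a : ℝ) : 0 < allocRate V u a :=
  div_pos hu (lt_max_of_lt_left hu)

lemma allocRate_le_one {V u : ℝ} (hu : 0 < u) (a : ℝ) : allocRate V u a ≤ 1 :=
  (div_le_one (lt_max_of_lt_left hu)).2 (le_max_left _ _)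

lemma allocRate_eq_one {V u a : ℝ} (hu : 0 < u) (h : V - u ≤ a) : allocRate V u a = 1 := by
  rw [allocRate, max_eq_left (by linarith), div_self hu.ne']

lemma allocRate_of_lt {V u a : ℝ} (h : a < V - u) : allocRate V u a = u / (V - a) := by
  rw [allocRate, max_eq_right (by linarith)]

/-- A potential for the deviating buyer: when report `b` and true value `c` are added to the
cumulative report `a` and cumulative value `w`, the gain is covered by the drop of
`allocRate V u a * (V - w)`. -/
lemma allocRate_potential_step {V u a b w c : ℝ} (hu : 0 < u) (ha : a < V - u) (hb : 0 ≤ b)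
    (haw : a ≤ w) (hbc : b ≤ c) :
    allocRate V u (a + b) * (V - (w + c)) + allocRate V u a * (c - b)
      ≤ allocRate V u a * (V - w) := by
  have hm : 0 < max u (V - (a + b)) := lt_max_of_lt_left hu
  have hV : 0 < V - a := by linarith
  have hle : max u (V - (a + b)) ≤ V - a := max_le (by linarith) (by linarith)
  have hr : V - (a + b) ≤ max u (V - (a + b)) := le_max_right _ _
  have key : allocRate V u (a + b) * (V - (w + c)) ≤ allocRate V u a * (V - (w + c) + b) := by
    rw [allocRate_of_lt ha, allocRate, div_mul_eq_mul_div, div_mul_eq_mul_div,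
      div_le_div_iff₀ hm hV]
    have h1 : (V - (w + c)) * (V - a) ≤ (V - (w + c) + b) * max u (V - (a + b)) := by
      nlinarith
    nlinarith
  nlinarith

/-- A buyer with values `v` imitating `v'` gains at most `u` apart from the last payment. -/
lemma deviation_gain_add_potential_le {T : ℕ} {V u : ℝ} {v v' : ℕ → ℝ} (hu : 0 < u)
    (huV : u ≤ V)
    (hv' : IsDType T v') (n : ℕ) (hn : n ≤ T)
    (h : ∀ t ∈ Finset.Icc 1 n, dPay V u v' t ≤ dAlloc V u v' t * v t) :
    (∑ t ∈ Finset.Icc 1 n, (dAlloc V u v' t * v t - dPay V u v' t))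
        + allocRate V u (cumValue v' n) * (V - cumValue v n) ≤ u ∧
      (cumValue v' n < V - u → cumValue v' n ≤ cumValue v n) := by
  induction n with
  | zero =>
    simp only [cumValue_zero, allocRate, sub_zero, max_eq_right huV]
    have : u / V * V = u := div_mul_cancel₀ u (by linarith)
    simp [this]
  | succ n ih =>
    obtain ⟨ih1, ih2⟩ := ih (by omega) fun t ht =>
      h t (Finset.Icc_subset_Icc_right (by omega) ht)
    have hlast := h (n + 1) (Finset.mem_Icc.2 ⟨by omega, le_rfl⟩)
    have hb := hv'.succ_mem hn
    rw [Finset.sum_Icc_succ_top (by omega)]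
    simp only [dPay, dAlloc, Nat.add_sub_cancel, cumValue_succ] at *
    by_cases ha : cumValue v' n < V - u
    · simp only [ha, if_true] at hlast ⊢
      have hbc := le_of_mul_le_mul_left hlast (allocRate_pos hu _)
      have := allocRate_potential_step hu ha hb.1 (ih2 ha) hbc
      refine ⟨by linarith, fun _ => add_le_add (ih2 ha) hbc⟩
    · have ha' := not_lt.1 ha
      simp only [ha, if_false]
      rw [allocRate_eq_one hu ha'] at *
      rw [allocRate_eq_one hu (show V - u ≤ cumValue v' n + v' (n + 1) by linarith)]
      refine ⟨by linarith, fun h' => by linarith⟩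

lemma truthful_utility_ge {T : ℕ} {V u : ℝ} {v : ℕ → ℝ} (hu : 0 < u) (huV : u ≤ V)
    (hv : IsDType T v) (n : ℕ) (hn : n ≤ T) :
    0 ≤ (∑ t ∈ Finset.Icc 1 n, (dAlloc V u v t * v t - dPay V u v t)) ∧
      cumValue v n - (V - u) - 1 ≤
        ∑ t ∈ Finset.Icc 1 n, (dAlloc V u v t * v t - dPay V u v t) := by
  induction n with
  | zero =>
    simp only [cumValue_zero]
    norm_num
    linarith
  | succ n ih =>
    obtain ⟨ih1, ih2⟩ := ih (by omega)
    have hb := hv.succ_mem hn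
    rw [Finset.sum_Icc_succ_top (by omega)]
    simp only [dPay, dAlloc, Nat.add_sub_cancel, cumValue_succ] at *
    by_cases ha : cumValue v n < V - u
    · simp only [ha, if_true]
      constructor <;> linarith
    · simp only [ha, if_false]
      rw [allocRate_eq_one hu (not_lt.1 ha)]
      constructor <;> linarith

lemma mul_log_div_le {u M N b : ℝ} (hu : 0 < u) (hN : 0 < N) (hNM : N ≤ M) (hb : M - N ≤ b)
    (hb1 : b ≤ 1) : u * Real.log (M / N) ≤ u / M * b + (u / N - u / M) := by
  have hM : 0 < M := hN.trans_le hNM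
  have hlog := Real.log_le_sub_one_of_pos (div_pos hM hN)
  have key : M / N - 1 ≤ b / M + (1 / N - 1 / M) := by
    rw [← sub_nonneg]
    have : b / M + (1 / N - 1 / M) - (M / N - 1)
        = ((b - (M - N)) * N + (M - N) * (1 - (M - N))) / (M * N) := by
      field_simp
      ring
    rw [this]
    refine div_nonneg (add_nonneg (mul_nonneg ?_ hN.le) (mul_nonneg ?_ ?_)) (by positivity) <;>
      linarith
  calc u * Real.log (M / N) ≤ u * (b / M + (1 / N - 1 / M)) := by gcongr; linarith
    _ = u / M * b + (u / N - u / M) := by ring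

lemma sum_pay_ge {T : ℕ} {V u : ℝ} {v : ℕ → ℝ} (hu : 0 < u) (huV : u ≤ V)
    (hv : IsDType T v) (n : ℕ) (hn : n ≤ T) :
    u * Real.log (V / max u (V - cumValue v n)) - allocRate V u (cumValue v n) ≤
      ∑ t ∈ Finset.Icc 1 n, dPay V u v t := by
  induction n with
  | zero =>
    have := allocRate_pos (V := V) hu 0
    have hV : V ≠ 0 := by linarith
    simp [cumValue_zero, max_eq_right huV, div_self hV, this.le]
  | succ n ih =>
    have ih := ih (by omega)
    have hb := hv.succ_mem hn
    rw [Finset.sum_Icc_succ_top (by omega)]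
    simp only [dPay, dAlloc, Nat.add_sub_cancel, cumValue_succ] at *
    by_cases ha : cumValue v n < V - u
    · simp only [ha, if_true]
      have hM : max u (V - cumValue v n) = V - cumValue v n := max_eq_right (by linarith)
      have hN : 0 < max u (V - (cumValue v n + v (n + 1))) := lt_max_of_lt_left hu
      have hNr := le_max_right u (V - (cumValue v n + v (n + 1)))
      have hNM : max u (V - (cumValue v n + v (n + 1))) ≤ V - cumValue v n :=
        max_le (by linarith) (by linarith)
      have step := mul_log_div_le (b := v (n + 1)) hu hN hNM (by linarith) hb.2
      simp only [allocRate, hM] at *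
      have hV : V ≠ 0 := by linarith
      have hVa : V - cumValue v n ≠ 0 := by linarith
      rw [Real.log_div hV hVa] at ih
      rw [Real.log_div hVa hN.ne'] at step
      rw [Real.log_div hV hN.ne']
      linarith
    · have ha' := not_lt.1 ha
      have ha'' : V - u ≤ cumValue v n + v (n + 1) := by linarith
      simp only [ha, if_false]
      rw [allocRate_eq_one hu ha', max_eq_left (by linarith)] at ih
      rw [allocRate_eq_one hu ha'', max_eq_left (by linarith)]
      linarith

/-- There is an absolute constant `C` such that for every `V ≥ 1` and every number
of rounds `T`, some truthful discrete single-buyer mechanism on types of total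
value `V` has revenue at least `V/e − C` on every such type, using reimbursements
of size at most `C`. -/
theorem stmt8 :
    ∃ C : ℝ, ∀ V : ℝ, 1 ≤ V → ∀ T : ℕ,
      ∃ (r x : (ℕ → ℝ) → ℕ → ℝ) (g : (ℕ → ℝ) → ℝ),
        DTruthfulG T V r x g ∧
        ∀ v, IsDType T v → (∑ t ∈ Finset.Icc 1 T, v t) = V →
          (∑ t ∈ Finset.Icc 1 T, x v t) - g v ≥ V / Real.exp 1 - C ∧ g v ≤ C := by
  refine ⟨3, fun V hV T => ?_⟩
  set u := V / Real.exp 1 with hu_def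
  have hu : 0 < u := div_pos (by linarith) (Real.exp_pos 1)
  have huV : u ≤ V := div_le_self (by linarith) (Real.one_le_exp zero_le_one)
  refine ⟨dAlloc V u, dPay V u, fun _ => 2, ⟨fun v hv _ => ⟨fun t ht => ?_, by norm_num⟩,
    fun v v' hv hv' hVv _ τ hτ h => ?_⟩, fun v hv hVv => ⟨?_, by norm_num⟩⟩
  · have h0 : 0 < dAlloc V u v t := allocRate_pos hu _
    have hvt := mul_nonneg h0.le (hv t ht).1
    refine ⟨⟨h0.le, allocRate_le_one hu _⟩, ?_⟩
    rw [dPay]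
    split_ifs
    · exact ⟨hvt, le_rfl⟩
    · exact ⟨le_rfl, hvt⟩
  · have hτ' := Finset.mem_Icc.1 hτ
    have hdev := (deviation_gain_add_potential_le hu huV hv' τ hτ'.2 h).1
    have hutil := (truthful_utility_ge hu huV hv T le_rfl).2
    have hlast := h τ (Finset.mem_Icc.2 ⟨hτ'.1, le_rfl⟩)
    have hle : dAlloc V u v' τ * v τ ≤ 1 :=
      mul_le_one₀ (allocRate_le_one hu _) (hv τ hτ).1 (hv τ hτ).2
    have hw := cumValue_le_of_le hv hτ'.2
    have hcum : cumValue v T = V := hVv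
    have hpot := mul_nonneg (allocRate_pos (V := V) hu (cumValue v' τ)).le
      (show 0 ≤ V - cumValue v τ by linarith)
    linarith
  · have hrev := sum_pay_ge hu huV hv T le_rfl
    have hcum : cumValue v T = V := hVv
    have hexp : V / u = Real.exp 1 := by
      rw [hu_def, div_div_cancel₀ (by linarith)]
    rw [hcum, sub_self, max_eq_left hu.le, hexp, Real.log_exp,
      allocRate_eq_one hu (by linarith)] at hrev
    linarith
end

section
/- Let α ∈ (0,1], β ≥ 0, V > 0, T ∈ ℕ, and let v'_1, …, v'_T ∈ [0,1] and r_1, …, r_T ∈ (0,1]; set w_t = r_t v'_t. Suppose that for every t ∈ {1, …, T}, V/α ≤ (β+1)/(α r_t) + V/r_t + (1/α) Σ_{s=1}^{t} v'_s. If τ ∈ {1, …, T} satisfies Σ_{t=1}^{τ} w_t ≥ (α log(1/α)) V, then Σ_{t=1}^{τ} v'_t ≥ (1 − α)V − e^{1/α}(β + 3). -/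
open Finset

/-- A potential argument: allocation rates bounded by `C / (V - Sₜ)`, where `Sₜ` are the partial
sums of values in `[0, 1]`, give a total welfare at most logarithmic in `V - Sₙ`. -/
theorem sum_mul_le_log_sub_log {C V : ℝ} (hC : 0 ≤ C) (v r : ℕ → ℝ) (n : ℕ)
    (hv : ∀ t ∈ Finset.Icc 1 n, v t ∈ Set.Icc (0 : ℝ) 1)
    (hr : ∀ t ∈ Finset.Icc 1 n, r t * (V - ∑ s ∈ Finset.Icc 1 t, v s) ≤ C)
    (hn : 1 < V - ∑ s ∈ Finset.Icc 1 n, v s) :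
    ∑ t ∈ Finset.Icc 1 n, r t * v t ≤
      C * (Real.log (V - 1) - Real.log (V - ∑ s ∈ Finset.Icc 1 n, v s - 1)) := by
  induction n with
  | zero => simp
  | succ n ih =>
    have hsub : Finset.Icc 1 n ⊆ Finset.Icc 1 (n + 1) := Finset.Icc_subset_Icc_right n.le_succ
    have hlast : n + 1 ∈ Finset.Icc 1 (n + 1) := by simp
    obtain ⟨hv0, hv1⟩ := hv _ hlast
    have hr1 := hr _ hlast
    rw [Finset.sum_Icc_succ_top (by omega)] at hn hr1 ⊢
    rw [Finset.sum_Icc_succ_top (by omega)]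
    set S := ∑ s ∈ Finset.Icc 1 n, v s
    have ih := ih (fun t ht => hv t (hsub ht)) (fun t ht => hr t (hsub ht)) (by linarith)
    set D := V - (S + v (n + 1)) with hD
    have hD' : V - S - 1 = D + v (n + 1) - 1 := by rw [hD]; ring
    rw [hD'] at ih
    have hx : 0 < D + v (n + 1) - 1 := by linarith
    have hy : 0 < D - 1 := by linarith
    have hlog : v (n + 1) / (D + v (n + 1) - 1) ≤
        Real.log (D + v (n + 1) - 1) - Real.log (D - 1) := by
      have h := Real.log_le_sub_one_of_pos (div_pos hy hx)
      rw [Real.log_div hy.ne' hx.ne'] at h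
      have : (D - 1) / (D + v (n + 1) - 1) - 1 = -(v (n + 1) / (D + v (n + 1) - 1)) := by
        field_simp
        ring
      linarith
    have hstep : r (n + 1) * v (n + 1) ≤ C * (v (n + 1) / (D + v (n + 1) - 1)) :=
      calc r (n + 1) * v (n + 1) ≤ C / D * v (n + 1) := by
            gcongr
            rwa [le_div_iff₀ (by linarith)]
        _ ≤ C / (D + v (n + 1) - 1) * v (n + 1) := by
            gcongr
            linarith
        _ = C * (v (n + 1) / (D + v (n + 1) - 1)) := by ring
    have := mul_le_mul_of_nonneg_left hlog hC
    linarith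

theorem sq_le_exp_of_nonneg {x : ℝ} (hx : 0 ≤ x) : x ^ 2 ≤ Real.exp x := by
  have h : x ≤ Real.exp (x / 2) := by
    have h1 := Real.add_one_le_exp (x / 2 - 1)
    have h2 := Real.add_one_le_exp 1
    have h3 : Real.exp (x / 2) = Real.exp 1 * Real.exp (x / 2 - 1) := by
      rw [← Real.exp_add]
      ring_nf
    rw [h3]
    nlinarith
  calc x ^ 2 ≤ Real.exp (x / 2) ^ 2 := by gcongr
    _ = Real.exp x := by rw [← Real.exp_nat_mul]; ring_nf

/-- If `K` dominates `(b + 2) / α ^ 2`, the excess `b` in the factor `α V + b` is compensated by the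
additive slack `K` inside the logarithm. -/
theorem mul_log_sub_log_le {α b K V : ℝ} (hα0 : 0 < α) (hα1 : α ≤ 1) (hb : 0 ≤ b)
    (hK : (b + 2) / α ^ 2 ≤ K) (hV : K ≤ V) :
    (α * V + b) * (Real.log (V - 1) - Real.log (α * V + K - 1)) ≤
      α * Real.log (1 / α) * V := by
  have hKα : b + 2 ≤ K * α ^ 2 := by rwa [div_le_iff₀ (by positivity)] at hK
  have hK2 : 2 ≤ K := by
    have : b + 2 ≤ (b + 2) / α ^ 2 :=
      le_div_self (by linarith) (by positivity) (pow_le_one₀ hα0.le hα1)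
    linarith
  have hP : 0 < α * V + K - 1 := by nlinarith
  have hV1 : 0 < V - 1 := by linarith
  set L := Real.log (1 / α) with hL
  have hL0 : 0 ≤ L := Real.log_nonneg (by rw [le_div_iff₀ hα0]; linarith)
  have hLα : α * L ≤ 1 - α := by
    have h := Real.log_le_sub_one_of_pos (one_div_pos.mpr hα0)
    calc α * L ≤ α * (1 / α - 1) := by gcongr
      _ = 1 - α := by field_simp
  have hlog : Real.log (V - 1) - Real.log (α * V + K - 1) ≤
      L - (K - 1 + α) / (α * V + K - 1) := by
    have h := Real.log_le_sub_one_of_pos (div_pos (mul_pos hα0 hV1) hP)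
    rw [Real.log_div (mul_pos hα0 hV1).ne' hP.ne', Real.log_mul hα0.ne' hV1.ne'] at h
    have hLeq : L = -Real.log α := by rw [hL, one_div, Real.log_inv]
    have : α * (V - 1) / (α * V + K - 1) - 1 = -((K - 1 + α) / (α * V + K - 1)) := by
      field_simp
      ring
    linarith
  have hslack : b * L * (1 + α) ≤ α * (K - 1 + α) := by
    have h1 : α * (b * L * (1 + α)) ≤ b := by
      calc α * (b * L * (1 + α)) = b * (1 + α) * (α * L) := by ring
        _ ≤ b * (1 + α) * (1 - α) := by gcongr
        _ ≤ b := by nlinarith [mul_nonneg hb (sq_nonneg α)]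
    have h2 : b ≤ α * (α * (K - 1 + α)) := by nlinarith [pow_pos hα0 3]
    exact le_of_mul_le_mul_left (h1.trans h2) hα0
  have hkey : b * L * (α * V + K - 1) ≤ (α * V + b) * (K - 1 + α) := by
    have h1 : V * (b * L * (1 + α)) ≤ V * (α * (K - 1 + α)) :=
      mul_le_mul_of_nonneg_left hslack (by linarith)
    have h2 : 0 ≤ b * L * (V - (K - 1)) := by
      have : 0 ≤ V - (K - 1) := by linarith
      positivity
    have h3 : 0 ≤ b * (K - 1 + α) := mul_nonneg hb (by linarith)
    linarith
  have hC : 0 ≤ α * V + b := by nlinarith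
  have hdiv : b * L ≤ (α * V + b) * ((K - 1 + α) / (α * V + K - 1)) := by
    rw [← mul_div_assoc, le_div_iff₀ hP]
    exact hkey
  have := mul_le_mul_of_nonneg_left hlog hC
  linarith

/-- Discrete analogue of the integral inequality: if
`V/α ≤ (β+1)/(α rₜ) + V/rₜ + (1/α) Σ_{s≤t} v'ₛ` holds in every round, and the
welfare collected through round `τ` is at least `(α log(1/α)) V`, then the total
value through round `τ` is at least `(1−α)V − e^{1/α}(β+3)`. -/
theorem stmt9 (α β V : ℝ) (T : ℕ) (v' r : ℕ → ℝ)
    (hα : α ∈ Set.Ioc (0:ℝ) 1) (hβ : 0 ≤ β) (hV : 0 < V)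
    (hv' : ∀ t ∈ Finset.Icc 1 T, v' t ∈ Set.Icc (0:ℝ) 1)
    (hr : ∀ t ∈ Finset.Icc 1 T, r t ∈ Set.Ioc (0:ℝ) 1)
    (hmain : ∀ t ∈ Finset.Icc 1 T,
      V / α ≤ (β + 1) / (α * r t) + V / r t + (1 / α) * ∑ s ∈ Finset.Icc 1 t, v' s)
    (τ : ℕ) (hτ : τ ∈ Finset.Icc 1 T)
    (hw : (∑ t ∈ Finset.Icc 1 τ, r t * v' t) ≥ α * Real.log (1 / α) * V) :
    (∑ t ∈ Finset.Icc 1 τ, v' t) ≥ (1 - α) * V - Real.exp (1 / α) * (β + 3) := by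
  obtain ⟨hα0, hα1⟩ := hα
  obtain ⟨-, hτT⟩ := Finset.mem_Icc.mp hτ
  have hsub : Finset.Icc 1 τ ⊆ Finset.Icc 1 T := Finset.Icc_subset_Icc_right hτT
  by_contra! hlt
  set K := Real.exp (1 / α) * (β + 3) with hK
  have hS0 : 0 ≤ ∑ t ∈ Finset.Icc 1 τ, v' t :=
    Finset.sum_nonneg fun t ht => (hv' t (hsub ht)).1
  have hKlow : (β + 1 + 2) / α ^ 2 ≤ K := by
    have h := sq_le_exp_of_nonneg (one_div_pos.mpr hα0).le
    calc (β + 1 + 2) / α ^ 2 = (1 / α) ^ 2 * (β + 3) := by field_simp; ring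
      _ ≤ K := by rw [hK]; gcongr
  have hK3 : 3 ≤ K := by
    have : β + 1 + 2 ≤ (β + 1 + 2) / α ^ 2 :=
      le_div_self (by linarith) (by positivity) (pow_le_one₀ hα0.le hα1)
    linarith
  have hαV : 0 < α * V := mul_pos hα0 hV
  have hrate : ∀ t ∈ Finset.Icc 1 τ,
      r t * (V - ∑ s ∈ Finset.Icc 1 t, v' s) ≤ α * V + (β + 1) := by
    intro t ht
    have hr0 := (hr t (hsub ht)).1
    have h := mul_le_mul_of_nonneg_left (hmain t (hsub ht)) (mul_pos hα0 hr0).le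
    have hl : α * r t * (V / α) = r t * V := by field_simp
    have hr' : α * r t * ((β + 1) / (α * r t) + V / r t + 1 / α * ∑ s ∈ Finset.Icc 1 t, v' s) =
        β + 1 + α * V + r t * ∑ s ∈ Finset.Icc 1 t, v' s := by field_simp
    rw [hl, hr'] at h
    linarith
  have hupper := sum_mul_le_log_sub_log (by linarith) v' r τ (fun t ht => hv' t (hsub ht)) hrate
    (by linarith)
  have hbound := mul_log_sub_log_le (V := V) hα0 hα1 (by linarith) hKlow (by linarith)
  have hlog : Real.log (α * V + K - 1) < Real.log (V - ∑ s ∈ Finset.Icc 1 τ, v' s - 1) :=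
    Real.log_lt_log (by linarith) (by linarith)
  have := mul_lt_mul_of_pos_left hlog (show 0 < α * V + (β + 1) by linarith)
  linarith
end

section
/- Let α > 0, V > 0, T ∈ ℕ, and let w_1, …, w_T ∈ [0,1] with W_t = Σ_{s=1}^{t} w_s and W_T ≤ V. Define λ_t = α · exp(W_t / (αV)) · (w_t / V). Then for every τ ∈ {1, …, T}, |Σ_{t=1}^{τ} λ_t − α²(exp(W_τ/(αV)) − 1)| ≤ α e^{1/α} / V. -/
open Finset

/-- The right-endpoint Riemann sum of `exp` on a partition of mesh at most `δ` overestimates the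
integral by at most `δ` times the increment of `exp`. -/
lemma sum_exp_mul_sub_mem_Icc (d : ℕ → ℝ) (δ : ℝ) (n : ℕ)
    (hd : ∀ t ∈ Finset.Icc 1 n, d t ∈ Set.Icc 0 δ) :
    (∑ t ∈ Finset.Icc 1 n, Real.exp (∑ s ∈ Finset.Icc 1 t, d s) * d t) -
        (Real.exp (∑ s ∈ Finset.Icc 1 n, d s) - 1) ∈
      Set.Icc 0 (δ * (Real.exp (∑ s ∈ Finset.Icc 1 n, d s) - 1)) := by
  induction n with
  | zero => simp
  | succ n ih =>
    obtain ⟨ih₀, ih₁⟩ := ih fun t ht => hd t (Finset.Icc_subset_Icc_right n.le_succ ht)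
    obtain ⟨h₀, h₁⟩ := hd (n + 1) (by simp)
    simp only [Finset.sum_Icc_succ_top (Nat.le_add_left 1 n)]
    generalize ∑ s ∈ Finset.Icc 1 n, d s = y at *
    generalize d (n + 1) = c at *
    have lower : Real.exp y * c ≤ Real.exp (y + c) - Real.exp y := by
      rw [Real.exp_add]
      nlinarith [Real.add_one_le_exp c, Real.exp_pos y]
    have upper : Real.exp (y + c) - Real.exp y ≤ Real.exp (y + c) * c := by
      have h : Real.exp y = Real.exp (y + c) * Real.exp (-c) := by
        rw [← Real.exp_add]; ring_nf
      nlinarith [Real.add_one_le_exp (-c), Real.exp_pos (y + c)]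
    have hinc : 0 ≤ Real.exp (y + c) - Real.exp y :=
      (mul_nonneg (Real.exp_pos y).le h₀).trans lower
    constructor
    · linarith
    · linarith [mul_le_mul_of_nonneg_right h₁ hinc]

/-- Riemann-sum error bound: with `W_t = Σ_{s≤t} w_s ≤ V` and
`λ_t = α exp(W_t/(αV)) (w_t/V)`, for every `τ ∈ {1,…,T}` the sum `Σ_{t≤τ} λ_t`
is within `α e^{1/α} / V` of `α²(exp(W_τ/(αV)) − 1)`. -/
theorem stmt10 (α V : ℝ) (T : ℕ) (w : ℕ → ℝ) (hα : 0 < α) (hV : 0 < V)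
    (hw : ∀ t ∈ Finset.Icc 1 T, w t ∈ Set.Icc (0:ℝ) 1)
    (hWT : (∑ s ∈ Finset.Icc 1 T, w s) ≤ V) :
    ∀ τ ∈ Finset.Icc 1 T,
      |(∑ t ∈ Finset.Icc 1 τ,
          α * Real.exp ((∑ s ∈ Finset.Icc 1 t, w s) / (α * V)) * (w t / V)) -
        α ^ 2 * (Real.exp ((∑ s ∈ Finset.Icc 1 τ, w s) / (α * V)) - 1)| ≤
      α * Real.exp (1 / α) / V := by
  intro τ hτ
  have hsub : Finset.Icc 1 τ ⊆ Finset.Icc 1 T :=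
    Finset.Icc_subset_Icc_right (Finset.mem_Icc.1 hτ).2
  have hαV : 0 < α * V := mul_pos hα hV
  obtain ⟨h₀, h₁⟩ := sum_exp_mul_sub_mem_Icc (fun t => w t / (α * V)) (1 / (α * V)) τ
    fun t ht => ⟨div_nonneg (hw t (hsub ht)).1 hαV.le,
      div_le_div_of_nonneg_right (hw t (hsub ht)).2 hαV.le⟩
  simp only [← Finset.sum_div] at h₀ h₁
  have hsum : (∑ t ∈ Finset.Icc 1 τ,
      α * Real.exp ((∑ s ∈ Finset.Icc 1 t, w s) / (α * V)) * (w t / V)) =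
      α ^ 2 * ∑ t ∈ Finset.Icc 1 τ,
        Real.exp ((∑ s ∈ Finset.Icc 1 t, w s) / (α * V)) * (w t / (α * V)) := by
    rw [Finset.mul_sum]
    refine Finset.sum_congr rfl fun t _ => ?_
    generalize Real.exp _ = E
    field_simp
  have hWτ : ∑ s ∈ Finset.Icc 1 τ, w s ≤ V :=
    (Finset.sum_le_sum_of_subset_of_nonneg hsub fun t ht _ => (hw t ht).1).trans hWT
  have hexp : Real.exp ((∑ s ∈ Finset.Icc 1 τ, w s) / (α * V)) ≤ Real.exp (1 / α) := by
    rw [Real.exp_le_exp, div_le_div_iff₀ hαV hα]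
    nlinarith
  rw [hsum, ← mul_sub, abs_of_nonneg (mul_nonneg (sq_nonneg α) h₀)]
  calc _ ≤ α ^ 2 * (1 / (α * V) * (Real.exp ((∑ s ∈ Finset.Icc 1 τ, w s) / (α * V)) - 1)) :=
        mul_le_mul_of_nonneg_left h₁ (sq_nonneg α)
    _ ≤ α ^ 2 * (1 / (α * V) * Real.exp (1 / α)) := by
        gcongr
        linarith
    _ = α * Real.exp (1 / α) / V := by
        generalize Real.exp _ = E
        field_simp
end

section
/- Fix any α > 2/e and β ≥ 0. Then for all sufficiently large T ∈ ℕ, there does not exist a truthful two-bidder mechanism over T rounds that satisfies Rev(v) ≥ α·RevSTB(v) − β for all type profiles v. -/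
open Finset

/-- A two-bidder type profile over `T` rounds (1-indexed): values in `[0,1]`. -/
def IsProfile (T : ℕ) (v : Fin 2 → ℕ → ℝ) : Prop :=
  ∀ i, ∀ t ∈ Finset.Icc 1 T, v i t ∈ Set.Icc (0:ℝ) 1

/-- The sell-the-business benchmark for two bidders: the smaller total value. -/
def RevSTB (T : ℕ) (v : Fin 2 → ℕ → ℝ) : ℝ :=
  min (∑ t ∈ Finset.Icc 1 T, v 0 t) (∑ t ∈ Finset.Icc 1 T, v 1 t)

/-- Revenue of a two-bidder mechanism: total payments minus reimbursements. -/
def Rev2 (T : ℕ) (x : (Fin 2 → ℕ → ℝ) → Fin 2 → ℕ → ℝ)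
    (g : (Fin 2 → ℕ → ℝ) → Fin 2 → ℝ) (v : Fin 2 → ℕ → ℝ) : ℝ :=
  (∑ i, ∑ t ∈ Finset.Icc 1 T, x v i t) - ∑ i, g v i

/-- A truthful two-bidder mechanism: feasible allocations, nonnegative payments
and reimbursements, limited liability, and dynamic incentive compatibility. -/
def Truthful2 (T : ℕ) (r x : (Fin 2 → ℕ → ℝ) → Fin 2 → ℕ → ℝ)
    (g : (Fin 2 → ℕ → ℝ) → Fin 2 → ℝ) : Prop :=
  (∀ v, IsProfile T v →
    (∀ i, 0 ≤ g v i) ∧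
    ∀ t ∈ Finset.Icc 1 T,
      (∀ i, r v i t ∈ Set.Icc (0:ℝ) 1 ∧ 0 ≤ x v i t ∧ x v i t ≤ r v i t * v i t) ∧
      r v 0 t + r v 1 t ≤ 1) ∧
  (∀ v, IsProfile T v → ∀ i, ∀ w : ℕ → ℝ, IsProfile T (Function.update v i w) →
    ∀ τ ∈ Finset.Icc 1 T,
      (∀ t ∈ Finset.Icc 1 τ,
        x (Function.update v i w) i t ≤ r (Function.update v i w) i t * v i t) →
      (∑ t ∈ Finset.Icc 1 T, (r v i t * v i t - x v i t)) + g v i ≥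
        (∑ t ∈ Finset.Icc 1 τ,
          (r (Function.update v i w) i t * v i t - x (Function.update v i w) i t)) +
          x (Function.update v i w) i τ)

/-- A stream of values, one per round, with values in `[0,1]` on rounds `1, …, T`. -/
def IsType (T : ℕ) (c : ℕ → ℝ) : Prop :=
  ∀ t ∈ Finset.Icc 1 T, c t ∈ Set.Icc (0:ℝ) 1

/-- The consequences of truthfulness for a single bidder facing a fixed opponent that drive the
revenue bound: `ρ` is the allocation, `U` the utility, and a bidder may imitate any
pointwise smaller type up to some round and then leave. -/
structure IsImitationProof (T : ℕ) (ρ : (ℕ → ℝ) → ℕ → ℝ) (U : (ℕ → ℝ) → ℝ) : Prop where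
  alloc_mem : ∀ c, IsType T c → ∀ t ∈ Finset.Icc 1 T, ρ c t ∈ Set.Icc (0:ℝ) 1
  utility_nonneg : ∀ c, IsType T c → 0 ≤ U c
  imitation : ∀ c c', IsType T c → IsType T c' → ∀ τ ∈ Finset.Icc 1 T,
    (∀ t ∈ Finset.Icc 1 τ, c t ≤ c' t) →
      U c' ≥ ∑ t ∈ Finset.Icc 1 τ, ρ c t * (c' t - c t)

/-- A type made of `N` successive cells of mass one, cell `k` being spread uniformly over the
`ℓ k` rounds starting at `a k` where `L ∣ ℓ k`, together with additional mass at most `n`. -/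
structure IsStaged (N T L n : ℕ) (c : ℕ → ℝ) (a ℓ : ℕ → ℕ) : Prop where
  one_le : 1 ≤ a 0
  step : ∀ k < N, a k + ℓ k ≤ a (k + 1)
  pos : ∀ k < N, 0 < ℓ k
  dvd : ∀ k < N, L ∣ ℓ k
  end_le : a N ≤ T + 1
  mem : ∀ t, c t ∈ Set.Icc (0:ℝ) 1
  val : ∀ k < N, ∀ t ∈ Finset.Ico (a k) (a k + ℓ k), c t = 1 / ℓ k
  zero : ∀ t, a N ≤ t → c t = 0
  mass : ∀ k ≤ N, ∑ t ∈ Finset.Ico 1 (a k), c t ≤ k + n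

namespace IsStaged

variable {N T L n : ℕ} {c : ℕ → ℝ} {a ℓ : ℕ → ℕ}

lemma isType (h : IsStaged N T L n c a ℓ) : IsType T c := fun t _ => h.mem t

lemma start_le (h : IsStaged N T L n c a ℓ) {i j : ℕ} (hij : i ≤ j) (hj : j ≤ N) :
    a i ≤ a j := by
  induction j, hij using Nat.le_induction with
  | base => exact le_rfl
  | succ j hij ih => exact (ih (by omega)).trans (by have := h.step j (by omega); omega)

lemma one_le_start (h : IsStaged N T L n c a ℓ) {k : ℕ} (hk : k ≤ N) : 1 ≤ a k :=
  h.one_le.trans (h.start_le (Nat.zero_le k) hk)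

lemma sum_cells_le_prefix (h : IsStaged N T L n c a ℓ) {f : ℕ → ℝ} {S : ℕ} (hS : a N ≤ S)
    (hf : ∀ t ∈ Finset.Ico 1 S, 0 ≤ f t) {K : ℕ} (hK : K ≤ N) :
    ∑ k ∈ Finset.range K, ∑ t ∈ Finset.Ico (a k) (a k + ℓ k), f t
      ≤ ∑ t ∈ Finset.Ico 1 (a K), f t := by
  induction K with
  | zero =>
    simp only [Finset.range_zero, Finset.sum_empty]
    refine Finset.sum_nonneg fun t ht => hf t ?_
    have := h.start_le (Nat.zero_le N) le_rfl
    simp only [Finset.mem_Ico] at ht ⊢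
    omega
  | succ K ih =>
    have h1 := h.one_le_start (k := K) (by omega)
    have h2 := h.step K (by omega)
    have h3 := h.start_le hK le_rfl
    rw [Finset.sum_range_succ, ← Finset.sum_Ico_consecutive f h1 (by omega : a K ≤ a (K + 1))]
    refine add_le_add (ih (by omega)) (Finset.sum_le_sum_of_subset_of_nonneg ?_ ?_)
    · exact Finset.Ico_subset_Ico_right h2
    · intro t ht _
      refine hf t ?_
      simp only [Finset.mem_Ico] at ht ⊢
      omega

lemma sum_cells_le (h : IsStaged N T L n c a ℓ) {f : ℕ → ℝ}
    (hf : ∀ t ∈ Finset.Icc 1 T, 0 ≤ f t) {K : ℕ} (hK : K ≤ N) :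
    ∑ k ∈ Finset.range K, ∑ t ∈ Finset.Ico (a k) (a k + ℓ k), f t
      ≤ ∑ t ∈ Finset.Icc 1 T, f t := by
  have hf' : ∀ t ∈ Finset.Ico 1 (T + 1), 0 ≤ f t := by
    intro t ht
    refine hf t ?_
    simp only [Finset.mem_Ico, Finset.mem_Icc] at ht ⊢
    omega
  refine (h.sum_cells_le_prefix h.end_le hf' hK).trans ?_
  refine Finset.sum_le_sum_of_subset_of_nonneg ?_ fun t ht _ => hf t ht
  have := h.start_le hK le_rfl
  have := h.end_le
  intro t ht
  simp only [Finset.mem_Ico, Finset.mem_Icc] at ht ⊢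
  omega

lemma sum_cell (h : IsStaged N T L n c a ℓ) {k : ℕ} (hk : k < N) :
    ∑ t ∈ Finset.Ico (a k) (a k + ℓ k), c t = 1 := by
  rw [Finset.sum_congr rfl (h.val k hk)]
  have := h.pos k hk
  simp
  field_simp

lemma le_total (h : IsStaged N T L n c a ℓ) : (N : ℝ) ≤ ∑ t ∈ Finset.Icc 1 T, c t := by
  refine le_trans (le_of_eq ?_) (h.sum_cells_le (fun t _ => (h.mem t).1) (le_refl N))
  rw [Finset.sum_congr rfl fun k hk => h.sum_cell (Finset.mem_range.1 hk)]
  simp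

lemma total_le (h : IsStaged N T L n c a ℓ) : ∑ t ∈ Finset.Icc 1 T, c t ≤ N + n := by
  refine le_trans (le_of_eq ?_) (h.mass N le_rfl)
  refine (Finset.sum_subset ?_ ?_).symm
  · have := h.end_le
    intro t ht
    simp only [Finset.mem_Ico, Finset.mem_Icc] at ht ⊢
    omega
  · intro t ht ht'
    refine h.zero t ?_
    simp only [Finset.mem_Ico, Finset.mem_Icc] at ht ht'
    omega

lemma mono (h : IsStaged N T L n c a ℓ) {L' n' : ℕ} (hL : L' ∣ L) (hn : n ≤ n') :
    IsStaged N T L' n' c a ℓ where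
  one_le := h.one_le
  step := h.step
  pos := h.pos
  dvd k hk := hL.trans (h.dvd k hk)
  end_le := h.end_le
  mem := h.mem
  val := h.val
  zero := h.zero
  mass k hk := (h.mass k hk).trans (by gcongr)

/-- The welfare of a staged type is at most the welfare of its first `K` cells plus the rest of
its mass. -/
lemma welfare_le (h : IsStaged N T L n c a ℓ) {q : ℕ → ℝ}
    (hq : ∀ t ∈ Finset.Icc 1 T, q t ∈ Set.Icc (0:ℝ) 1) {K : ℕ} (hK : K ≤ N) :
    ∑ t ∈ Finset.Icc 1 T, q t * c t
      ≤ (N - K + n) + ∑ k ∈ Finset.range K,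
          1 / (ℓ k : ℝ) * ∑ t ∈ Finset.Ico (a k) (a k + ℓ k), q t := by
  have h1 := h.sum_cells_le (f := fun t => (1 - q t) * c t)
    (fun t ht => mul_nonneg (by linarith [(hq t ht).2]) (h.mem t).1) hK
  have h2 : ∀ k ∈ Finset.range K, ∑ t ∈ Finset.Ico (a k) (a k + ℓ k), (1 - q t) * c t
      = 1 - 1 / (ℓ k : ℝ) * ∑ t ∈ Finset.Ico (a k) (a k + ℓ k), q t := by
    intro k hk
    have hk' : k < N := by have := Finset.mem_range.1 hk; omega
    rw [eq_sub_iff_add_eq, Finset.mul_sum, ← Finset.sum_add_distrib]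
    refine Eq.trans ?_ (h.sum_cell hk')
    refine Finset.sum_congr rfl fun t ht => ?_
    rw [h.val k hk' t ht]
    ring
  rw [Finset.sum_congr rfl h2, Finset.sum_sub_distrib] at h1
  have h3 : ∑ t ∈ Finset.Icc 1 T, (1 - q t) * c t
      = ∑ t ∈ Finset.Icc 1 T, c t - ∑ t ∈ Finset.Icc 1 T, q t * c t := by
    rw [← Finset.sum_sub_distrib]
    exact Finset.sum_congr rfl fun t _ => by ring
  have h4 := h.total_le
  simp only [Finset.sum_const, Finset.card_range, nsmul_eq_mul, mul_one] at h1
  linarith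

end IsStaged

/-- Follow `c` before round `b`, then put value `1 / L` on `m` rounds, then nothing. -/
noncomputable def burst (c : ℕ → ℝ) (b m L : ℕ) (t : ℕ) : ℝ :=
  if t < b then c t else if t < b + m then 1 / (L : ℝ) else 0

namespace IsStaged

variable {N T L n : ℕ} {c : ℕ → ℝ} {a ℓ : ℕ → ℕ}

/-- Compressing everything from cell `k` on into a window of that cell gives a staged type. -/
lemma burst (h : IsStaged N T L n c a ℓ) {k b L' : ℕ} (hk : k < N) (hL' : 0 < L')
    (hL : L' ∣ L) (hb : a k ≤ b) (hb' : b + (N - k) * L' ≤ a k + ℓ k) :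
    IsStaged N T L' (n + 1) (burst c b ((N - k) * L') L')
      (fun i => if i < k then a i else b + (i - k) * L')
      (fun i => if i < k then ℓ i else L') := by
  have hak := h.one_le_start hk.le
  have hkN : a k + ℓ k ≤ a N := (h.step k hk).trans (h.start_le hk le_rfl)
  have hL1 : (1:ℝ) ≤ L' := by exact_mod_cast hL'
  have hpre : ∀ s ≤ b, ∑ t ∈ Finset.Ico 1 s, _root_.burst c b ((N - k) * L') L' t
      = ∑ t ∈ Finset.Ico 1 s, c t := by
    intro s hs
    refine Finset.sum_congr rfl fun t ht => ?_
    have : t < b := by have := (Finset.mem_Ico.1 ht).2; omega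
    simp [_root_.burst, this]
  have hmb : ∑ t ∈ Finset.Ico 1 b, c t ≤ k + n + 1 := by
    rw [← Finset.sum_Ico_consecutive c hak hb]
    refine add_le_add (h.mass k hk.le) ((Finset.sum_le_sum_of_subset_of_nonneg ?_ ?_).trans
      (h.sum_cell hk).le)
    · exact Finset.Ico_subset_Ico_right (by omega)
    · exact fun t _ _ => (h.mem t).1
  constructor
  · have := h.one_le
    by_cases h0 : 0 < k <;> simp [h0] <;> omega
  · intro i hi
    by_cases h1 : i + 1 < k
    · have : i < k := by omega
      simpa [h1, this] using h.step i hi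
    · by_cases h2 : i < k
      · obtain rfl : k = i + 1 := by omega
        have := h.step i hi
        simp
        omega
      · have : i + 1 - k = i - k + 1 := by omega
        simp [h1, h2, this, add_mul, add_assoc]
  · intro i hi
    by_cases h2 : i < k <;> simp [h2, hL', h.pos i hi]
  · intro i hi
    by_cases h2 : i < k <;> simp [h2, hL.trans (h.dvd i hi)]
  · have := h.end_le
    simp [hk.not_gt]
    omega
  · intro t
    unfold _root_.burst
    split_ifs
    · exact h.mem t
    · exact ⟨by positivity, by rw [div_le_one (by linarith)]; exact hL1⟩
    · simp
  · intro i hi t ht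
    by_cases h2 : i < k
    · simp only [h2, if_true] at ht ⊢
      have h3 := h.step i hi
      have h4 := h.start_le (show i + 1 ≤ k by omega) hk.le
      have h5 := (Finset.mem_Ico.1 ht).2
      rw [_root_.burst, if_pos (by omega)]
      exact h.val i hi t ht
    · simp only [h2, if_false, Finset.mem_Ico] at ht ⊢
      have h3 : (i - k) * L' + L' ≤ (N - k) * L' := by
        rw [← Nat.succ_mul]
        exact Nat.mul_le_mul_right _ (by omega)
      rw [_root_.burst, if_neg (by omega), if_pos (by omega)]
  · intro t ht
    simp only [hk.not_gt, if_false] at ht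
    rw [_root_.burst, if_neg (by omega), if_neg (by omega)]
  · intro i hi
    push_cast
    by_cases h2 : i < k
    · simp only [h2, if_true]
      have h4 := h.start_le h2.le hk.le
      rw [hpre _ (by omega)]
      linarith [h.mass i hi]
    · simp only [h2, if_false]
      rw [← Finset.sum_Ico_consecutive _ (by omega : 1 ≤ b) (by omega : b ≤ b + (i - k) * L'),
        hpre b le_rfl]
      have h3 : (i - k) * L' ≤ (N - k) * L' := Nat.mul_le_mul_right _ (by omega)
      have h5 : ∑ t ∈ Finset.Ico b (b + (i - k) * L'), _root_.burst c b ((N - k) * L') L' t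
          = (i:ℝ) - k := by
        rw [Finset.sum_congr rfl (g := fun _ => 1 / (L' : ℝ))]
        · have : L' ≠ 0 := hL'.ne'
          simp [Nat.cast_sub (not_lt.1 h2)]
          field_simp
        · intro t ht
          rw [Finset.mem_Ico] at ht
          rw [_root_.burst, if_neg (by omega), if_pos (by omega)]
      linarith

/-- The utility of a burst type is at least what it gains by imitating the original type. -/
lemma burst_utility (h : IsStaged N T L n c a ℓ) {k b L' : ℕ} (hk : k < N) (hL' : 0 < L')
    (hL : L' ∣ L) (hb : a k ≤ b) (hb' : b + (N - k) * L' ≤ a k + ℓ k)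
    {ρ : (ℕ → ℝ) → ℕ → ℝ} {U : (ℕ → ℝ) → ℝ} (hU : IsImitationProof T ρ U) :
    (1 / (L' : ℝ) - 1 / (ℓ k : ℝ)) * ∑ t ∈ Finset.Ico b (b + (N - k) * L'), ρ c t
      ≤ U (_root_.burst c b ((N - k) * L') L') := by
  have hak := h.one_le_start hk.le
  have hkN : a k + ℓ k ≤ a N := (h.step k hk).trans (h.start_le hk le_rfl)
  have hTN := h.end_le
  have hm : 0 < (N - k) * L' := Nat.mul_pos (by omega) hL'
  have hLl : (L' : ℝ) ≤ ℓ k := by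
    exact_mod_cast Nat.le_of_dvd (h.pos k hk) (hL.trans (h.dvd k hk))
  have hLpos : (0:ℝ) < L' := by exact_mod_cast hL'
  have hval : ∀ t ∈ Finset.Ico b (b + (N - k) * L'),
      _root_.burst c b ((N - k) * L') L' t = 1 / L' ∧ c t = 1 / ℓ k := by
    intro t ht
    rw [Finset.mem_Ico] at ht
    refine ⟨by rw [_root_.burst, if_neg (by omega), if_pos (by omega)], h.val k hk t ?_⟩
    rw [Finset.mem_Ico]
    omega
  have hpre : ∀ t < b, _root_.burst c b ((N - k) * L') L' t = c t := by
    intro t ht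
    rw [_root_.burst, if_pos ht]
  have key := hU.imitation c _ h.isType (h.burst hk hL' hL hb hb').isType
    (b + (N - k) * L' - 1) (by rw [Finset.mem_Icc]; omega) (by
      intro t ht
      rw [Finset.mem_Icc] at ht
      by_cases htb : t < b
      · rw [hpre t htb]
      · obtain ⟨h1, h2⟩ := hval t (by rw [Finset.mem_Ico]; omega)
        rw [h1, h2]
        exact one_div_le_one_div_of_le hLpos hLl)
  refine le_trans (le_of_eq ?_) key
  rw [Finset.mul_sum]
  have hsub : Finset.Ico b (b + (N - k) * L') ⊆ Finset.Icc 1 (b + (N - k) * L' - 1) := by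
    intro t ht
    rw [Finset.mem_Ico] at ht
    rw [Finset.mem_Icc]
    omega
  rw [← Finset.sum_subset hsub]
  · refine Finset.sum_congr rfl fun t ht => ?_
    obtain ⟨h1, h2⟩ := hval t ht
    rw [h1, h2]
    ring
  · intro t ht ht'
    rw [Finset.mem_Icc] at ht
    rw [Finset.mem_Ico] at ht'
    rw [hpre t (by omega)]
    ring

end IsStaged

lemma sum_windows (f : ℕ → ℝ) (s m W : ℕ) :
    ∑ w ∈ Finset.range W, ∑ t ∈ Finset.Ico (s + w * m) (s + w * m + m), f t
      = ∑ t ∈ Finset.Ico s (s + W * m), f t := by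
  induction W with
  | zero => simp
  | succ W ih =>
    rw [Finset.sum_range_succ, ih, Finset.sum_Ico_consecutive _ (by omega) (by omega), add_mul,
      one_mul, add_assoc]

namespace IsStaged

variable {N T L n : ℕ} {c : ℕ → ℝ} {a ℓ : ℕ → ℕ}

/-- A uniformly random window of cell `k` yields bursts whose average utility is at least
`N - k` times the average allocation of the cell, up to a small loss. -/
lemma avg_burst_utility (h : IsStaged N T L n c a ℓ) {k W L' : ℕ} (hk : k < N) (hL' : 0 < L')
    (hL : L' ∣ L) (hW : ℓ k = W * ((N - k) * L'))
    {ρ : (ℕ → ℝ) → ℕ → ℝ} {U : (ℕ → ℝ) → ℝ} (hU : IsImitationProof T ρ U) :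
    1 / (ℓ k : ℝ) * (∑ t ∈ Finset.Ico (a k) (a k + ℓ k), ρ c t) - 1 / (N - k : ℕ)
      ≤ ∑ w : Fin W, 1 / ((N - k : ℕ) * W : ℝ) *
          U (_root_.burst c (a k + w * ((N - k) * L')) ((N - k) * L') L') := by
  have hl := h.pos k hk
  have hWpos : 0 < W := by
    rcases Nat.eq_zero_or_pos W with h0 | h0
    · simp [h0] at hW; omega
    · exact h0
  have hak := h.one_le_start hk.le
  have hkN : a k + ℓ k ≤ a N := (h.step k hk).trans (h.start_le hk le_rfl)
  have hTN := h.end_le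
  have hR : 0 < N - k := by omega
  set R := N - k with hRdef
  have hRr : (1:ℝ) ≤ R := by exact_mod_cast hR
  have hWr : (1:ℝ) ≤ W := by exact_mod_cast hWpos
  have hLr : (1:ℝ) ≤ L' := by exact_mod_cast hL'
  have hlr : (ℓ k : ℝ) = W * (R * L') := by exact_mod_cast hW
  set S := ∑ t ∈ Finset.Ico (a k) (a k + ℓ k), ρ c t with hS
  have hSle : S ≤ ℓ k := by
    calc S ≤ ∑ t ∈ Finset.Ico (a k) (a k + ℓ k), (1:ℝ) := by
          refine Finset.sum_le_sum fun t ht => ?_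
          rw [Finset.mem_Ico] at ht
          exact (hU.alloc_mem c h.isType t (by rw [Finset.mem_Icc]; omega)).2
      _ = ℓ k := by simp
  have hwin : ∑ w : Fin W, ((1 / (L' : ℝ) - 1 / (ℓ k : ℝ)) *
      ∑ t ∈ Finset.Ico (a k + w * (R * L')) (a k + w * (R * L') + R * L'), ρ c t)
      = (1 / (L' : ℝ) - 1 / (ℓ k : ℝ)) * S := by
    rw [← Finset.mul_sum, hS]
    congr 1
    rw [hW, ← sum_windows]
    exact Fin.sum_univ_eq_sum_range
      (fun w => ∑ t ∈ Finset.Ico (a k + w * (R * L')) (a k + w * (R * L') + R * L'), ρ c t) W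
  have hle : (1 / (L' : ℝ) - 1 / (ℓ k : ℝ)) * S
      ≤ ∑ w : Fin W, U (_root_.burst c (a k + w * (R * L')) (R * L') L') := by
    rw [← hwin]
    refine Finset.sum_le_sum fun w _ => h.burst_utility hk hL' hL (by omega) ?_ hU
    have h1 : (w : ℕ) * (R * L') + R * L' ≤ W * (R * L') := by
      rw [← Nat.succ_mul]
      exact Nat.mul_le_mul_right _ w.2
    rw [← hRdef]
    omega
  rw [← Finset.mul_sum]
  refine le_trans ?_ (mul_le_mul_of_nonneg_left hle (by positivity))
  have hl1 : (1:ℝ) ≤ ℓ k := by exact_mod_cast hl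
  have e1 : 1 / (R * W : ℝ) * ((1 / (L' : ℝ) - 1 / (ℓ k : ℝ)) * S)
      = 1 / (ℓ k : ℝ) * S - 1 / (R * W : ℝ) * (S / ℓ k) := by
    rw [hlr]
    field_simp
  rw [e1]
  have h2 : S / ℓ k ≤ 1 := by rw [div_le_one (by linarith)]; exact hSle
  have h3 : 1 / (R * W : ℝ) * (S / ℓ k) ≤ 1 / (R * W : ℝ) :=
    mul_le_of_le_one_right (by positivity) h2
  have h4 : 1 / (R * W : ℝ) ≤ 1 / (R : ℝ) :=
    one_div_le_one_div_of_le (by linarith) (by nlinarith)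
  linarith

/-- From a staged type one obtains a distribution over faster staged types whose expected
utility dominates the welfare of the original type, up to the mass beyond its first
`K` cells. -/
lemma exists_faster (h : IsStaged N T L n c a ℓ) {K L' : ℕ} (hK : K ≤ N) (hL' : 0 < L')
    (hL : L = N.factorial * L') (hsum : ∑ k ∈ Finset.range K, 1 / ((N - k : ℕ) : ℝ) ≤ 1) :
    ∃ (ι : Type) (_ : Fintype ι) (p : ι → ℝ) (d : ι → ℕ → ℝ),
      (∀ i, 0 ≤ p i) ∧ ∑ i, p i = 1 ∧ (∀ i, ∃ a' ℓ', IsStaged N T L' (n + 1) (d i) a' ℓ') ∧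
      ∀ ρ U, IsImitationProof T ρ U →
        ∑ t ∈ Finset.Icc 1 T, ρ c t * c t ≤ (N - K + n + 1) + ∑ i, p i * U (d i) := by
  have hdvd : L' ∣ L := by rw [hL]; exact dvd_mul_left _ _
  have hex : ∀ k : Fin K, ∃ W, ℓ k = W * ((N - k) * L') := by
    intro k
    have h1 : (N - k) ∣ N.factorial := Nat.dvd_factorial (by omega) (by omega)
    have h2 : (N - k) * L' ∣ ℓ k := by
      refine dvd_trans ?_ (h.dvd k (by omega))
      rw [hL]
      exact Nat.mul_dvd_mul_right h1 _
    exact exists_eq_mul_left_of_dvd h2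
  choose W hW using hex
  have hWpos : ∀ k, (0:ℝ) < W k := by
    intro k
    have := h.pos k (by omega)
    rcases Nat.eq_zero_or_pos (W k) with h0 | h0
    · have h1 := hW k
      simp [h0] at h1
      omega
    · exact_mod_cast h0
  have hW1 : ∀ k : Fin K, ∑ _w : Fin (W k), 1 / ((N - k : ℕ) * W k : ℝ)
      = 1 / ((N - k : ℕ) : ℝ) := by
    intro k
    have := hWpos k
    have : (0:ℝ) < (N - k : ℕ) := by exact_mod_cast (by omega : 0 < N - (k:ℕ))
    simp only [Finset.sum_const, Finset.card_univ, Fintype.card_fin, nsmul_eq_mul]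
    field_simp
  have hsum' : ∑ k : Fin K, 1 / ((N - k : ℕ) : ℝ) ≤ 1 :=
    (Fin.sum_univ_eq_sum_range (fun k => 1 / ((N - k : ℕ) : ℝ)) K).trans_le hsum
  refine ⟨Option ((k : Fin K) × Fin (W k)), inferInstance,
    fun o => o.elim (1 - ∑ k : Fin K, 1 / ((N - k : ℕ) : ℝ))
      fun q => 1 / ((N - q.1 : ℕ) * W q.1 : ℝ),
    fun o => o.elim c
      fun q => _root_.burst c (a q.1 + q.2 * ((N - q.1) * L')) ((N - q.1) * L') L',
    ?_, ?_, ?_, ?_⟩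
  · rintro (_ | q)
    · simpa using hsum'
    · simp only [Option.elim]
      positivity
  · rw [Fintype.sum_option, Fintype.sum_sigma]
    simp only [Option.elim]
    rw [Finset.sum_congr rfl fun k _ => hW1 k]
    ring
  · rintro (_ | q)
    · exact ⟨a, ℓ, h.mono hdvd (Nat.le_succ n)⟩
    · refine ⟨_, _, h.burst (k := q.1) (by omega) hL' hdvd (by omega) ?_⟩
      have h1 : (q.2 : ℕ) * ((N - q.1) * L') + (N - q.1) * L' ≤ W q.1 * ((N - q.1) * L') := by
        rw [← Nat.succ_mul]
        exact Nat.mul_le_mul_right _ q.2.2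
      rw [hW q.1]
      omega
  · intro ρ U hU
    refine (h.welfare_le (hU.alloc_mem c h.isType) hK).trans ?_
    rw [Fintype.sum_option, Fintype.sum_sigma]
    simp only [Option.elim]
    have h1 : 0 ≤ (1 - ∑ k : Fin K, 1 / ((N - k : ℕ) : ℝ)) * U c :=
      mul_nonneg (by linarith) (hU.utility_nonneg c h.isType)
    have h2 : ∑ k : Fin K, (1 / (ℓ k : ℝ) * (∑ t ∈ Finset.Ico (a k) (a k + ℓ k), ρ c t)
        - 1 / ((N - k : ℕ) : ℝ)) ≤ _ :=
      Finset.sum_le_sum fun k _ => h.avg_burst_utility (by omega) hL' hdvd (hW k) hU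
    rw [Finset.sum_sub_distrib] at h2
    have h3 := Fin.sum_univ_eq_sum_range
      (fun k => 1 / (ℓ k : ℝ) * ∑ t ∈ Finset.Ico (a k) (a k + ℓ k), ρ c t) K
    rw [← h3]
    linarith

/-- Spreading every cell uniformly over `L` consecutive rounds gives a staged type. -/
lemma exists_initial (hL : 0 < L) (hT : N * L ≤ T) : ∃ c a ℓ, IsStaged N T L 0 c a ℓ := by
  have hL1 : (1:ℝ) ≤ L := by exact_mod_cast hL
  refine ⟨fun t => if t < 1 + N * L then 1 / (L : ℝ) else 0, fun k => 1 + k * L, fun _ => L,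
    by simp, fun k _ => ?_, fun _ _ => hL, fun _ _ => dvd_rfl, by omega, fun t => ?_,
    fun k hk t ht => ?_, fun t ht => ?_, fun k hk => ?_⟩
  · rw [add_mul]
    omega
  · split_ifs
    · exact ⟨by positivity, by rw [div_le_one (by linarith)]; exact hL1⟩
    · simp
  · have h3 : (k + 1) * L ≤ N * L := Nat.mul_le_mul_right _ hk
    rw [add_mul] at h3
    rw [Finset.mem_Ico] at ht
    exact if_pos (by omega)
  · exact if_neg (by omega)
  · have h3 : k * L ≤ N * L := Nat.mul_le_mul_right _ hk
    rw [Finset.sum_congr rfl (g := fun _ => 1 / (L : ℝ))]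
    · simp
      field_simp
      exact le_rfl
    · intro t ht
      rw [Finset.mem_Ico] at ht
      exact if_pos (by omega)

end IsStaged

/-- Total value to the bidder minus utility, i.e. the revenue collected from the bidder. -/
noncomputable def bidderRev (T : ℕ) (ρ : (ℕ → ℝ) → ℕ → ℝ) (U : (ℕ → ℝ) → ℝ) (c : ℕ → ℝ) : ℝ :=
  ∑ t ∈ Finset.Icc 1 T, ρ c t * c t - U c

/-- Types of mass between `N` and `N + M`. -/
def HasMass (N M T : ℕ) (c : ℕ → ℝ) : Prop :=
  IsType T c ∧ (N : ℝ) ≤ ∑ t ∈ Finset.Icc 1 T, c t ∧ ∑ t ∈ Finset.Icc 1 T, c t ≤ N + M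

lemma IsStaged.hasMass {N T L n M : ℕ} {c : ℕ → ℝ} {a ℓ : ℕ → ℕ}
    (h : IsStaged N T L n c a ℓ) (hn : n ≤ M) : HasMass N M T c :=
  ⟨h.isType, h.le_total, h.total_le.trans (by gcongr)⟩

/-- Iterating `IsStaged.exists_faster`: the revenues collected from successive
random types telescope. -/
lemma exists_staged_families {N M K T : ℕ} (hK : K ≤ N)
    (hsum : ∑ k ∈ Finset.range K, 1 / ((N - k : ℕ) : ℝ) ≤ 1)
    (hT : N * N.factorial ^ M ≤ T) {n : ℕ} (hn : n ≤ M) :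
    ∃ (ι κ : Type) (_ : Fintype ι) (_ : Fintype κ) (p : ι → ℝ) (q : κ → ℝ)
      (c : ι → ℕ → ℝ) (d : κ → ℕ → ℝ),
      (∀ i, 0 ≤ p i) ∧ ∑ i, p i = n ∧ (∀ i, HasMass N M T (c i)) ∧
      (∀ j, 0 ≤ q j) ∧ ∑ j, q j = 1 ∧
      (∀ j, ∃ a ℓ, IsStaged N T (N.factorial ^ (M - n)) n (d j) a ℓ) ∧
      ∀ ρ U, IsImitationProof T ρ U →
        ∑ i, p i * bidderRev T ρ U (c i)
          ≤ n * ((N : ℝ) - K + M + 1) + ∑ j, q j * U (d j) := by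
  induction n with
  | zero =>
    obtain ⟨c, a, ℓ, h⟩ := IsStaged.exists_initial (N := N) (T := T)
      (pow_pos (Nat.factorial_pos N) M) hT
    refine ⟨Empty, Unit, inferInstance, inferInstance, fun _ => 0, fun _ => 1, fun _ => c,
      fun _ => c, by simp, by simp, by simp, by simp, by simp, fun _ => ⟨a, ℓ, h⟩, ?_⟩
    intro ρ U hU
    simpa using hU.utility_nonneg c h.isType
  | succ n ih =>
    obtain ⟨ι, κ, _, _, p, q, c, d, hp, hp1, hc, hq, hq1, hd, hrev⟩ := ih (by omega)
    choose a ℓ hd using hd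
    have hL : N.factorial ^ (M - n) = N.factorial * N.factorial ^ (M - (n + 1)) := by
      rw [← pow_succ']
      congr 1
      omega
    choose κ' _ q' d' hq' hq1' hd' hrev' using fun j =>
      (hd j).exists_faster hK (pow_pos (Nat.factorial_pos N) (M - (n + 1))) hL hsum
    refine ⟨ι ⊕ κ, (j : κ) × κ' j, inferInstance, inferInstance, Sum.elim p q,
      fun z => q z.1 * q' z.1 z.2, Sum.elim c d, fun z => d' z.1 z.2, ?_, ?_, ?_, ?_, ?_, ?_, ?_⟩
    · rintro (i | j)
      exacts [hp i, hq j]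
    · simp [hp1, hq1]
    · rintro (i | j)
      exacts [hc i, (hd j).hasMass (by omega)]
    · exact fun z => mul_nonneg (hq z.1) (hq' z.1 z.2)
    · rw [Fintype.sum_sigma]
      simp only [← Finset.mul_sum, hq1', mul_one, hq1]
    · exact fun z => hd' z.1 z.2
    · intro ρ U hU
      rw [Fintype.sum_sum_type, Fintype.sum_sigma]
      simp only [Sum.elim_inl, Sum.elim_inr, mul_assoc, ← Finset.mul_sum]
      have hnM : (n : ℝ) ≤ M := by exact_mod_cast (by omega : n ≤ M)
      have h1 : ∑ j, q j * bidderRev T ρ U (d j)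
          ≤ ∑ j, (q j * ((N : ℝ) - K + M + 1) + q j * (∑ i, q' j i * U (d' j i))
            - q j * U (d j)) := by
        refine Finset.sum_le_sum fun j _ => ?_
        have h2 := hrev' j ρ U hU
        have h3 : bidderRev T ρ U (d j)
            ≤ ((N : ℝ) - K + M + 1) + (∑ i, q' j i * U (d' j i)) - U (d j) := by
          unfold bidderRev
          linarith
        calc q j * bidderRev T ρ U (d j) ≤ q j * _ := mul_le_mul_of_nonneg_left h3 (hq j)
          _ = _ := by ring
      rw [Finset.sum_sub_distrib, Finset.sum_add_distrib, ← Finset.sum_mul, hq1, one_mul] at h1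
      have h4 := hrev ρ U hU
      push_cast
      linarith

lemma isProfile_update {T : ℕ} {v : Fin 2 → ℕ → ℝ} (hv : IsProfile T v) (i : Fin 2)
    {w : ℕ → ℝ} (hw : IsType T w) : IsProfile T (Function.update v i w) := by
  intro j
  by_cases hj : j = i
  · subst hj
    rw [Function.update_self]
    exact hw
  · rw [Function.update_of_ne hj]
    exact hv j

/-- The utility of bidder `i` under truthful reporting. -/
noncomputable def utility (T : ℕ) (r x : (Fin 2 → ℕ → ℝ) → Fin 2 → ℕ → ℝ)
    (g : (Fin 2 → ℕ → ℝ) → Fin 2 → ℝ) (v : Fin 2 → ℕ → ℝ) (i : Fin 2) : ℝ :=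
  ∑ t ∈ Finset.Icc 1 T, (r v i t * v i t - x v i t) + g v i

lemma Truthful2.isImitationProof {T : ℕ} {r x : (Fin 2 → ℕ → ℝ) → Fin 2 → ℕ → ℝ}
    {g : (Fin 2 → ℕ → ℝ) → Fin 2 → ℝ} (h : Truthful2 T r x g) {v : Fin 2 → ℕ → ℝ}
    (hv : IsProfile T v) (i : Fin 2) :
    IsImitationProof T (fun w => r (Function.update v i w) i)
      (fun w => utility T r x g (Function.update v i w) i) where
  alloc_mem c hc t ht := ((h.1 _ (isProfile_update hv i hc)).2 t ht).1 i |>.1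
  utility_nonneg c hc := by
    obtain ⟨h1, h2⟩ := h.1 _ (isProfile_update hv i hc)
    exact add_nonneg (Finset.sum_nonneg fun t ht => sub_nonneg.2 ((h2 t ht).1 i).2.2) (h1 i)
  imitation c c' hc hc' τ hτ hle := by
    obtain ⟨-, h2⟩ := h.1 _ (isProfile_update hv i hc)
    have hsub : ∀ t ∈ Finset.Icc 1 τ, t ∈ Finset.Icc 1 T := by
      intro t ht
      rw [Finset.mem_Icc] at *
      omega
    have key := h.2 (Function.update v i c') (isProfile_update hv i hc') i c
      (by rw [Function.update_idem]; exact isProfile_update hv i hc) τ hτ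
    simp only [Function.update_idem, Function.update_self] at key
    have hx : ∀ t ∈ Finset.Icc 1 τ, x (Function.update v i c) i t
        ≤ r (Function.update v i c) i t * c t := by
      intro t ht
      have := ((h2 t (hsub t ht)).1 i).2.2
      simpa using this
    have key := key fun t ht => (hx t ht).trans
      (mul_le_mul_of_nonneg_left (hle t ht) ((h2 t (hsub t ht)).1 i).1.1)
    have h3 : ∑ t ∈ Finset.Icc 1 τ, r (Function.update v i c) i t * (c' t - c t)
        ≤ ∑ t ∈ Finset.Icc 1 τ,
          (r (Function.update v i c) i t * c' t - x (Function.update v i c) i t) := by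
      refine Finset.sum_le_sum fun t ht => ?_
      rw [mul_sub]
      linarith [hx t ht]
    have h4 := ((h2 τ hτ).1 i).2.1
    simp only [utility, Function.update_self]
    linarith

lemma update_zero_pair (c d w : ℕ → ℝ) : Function.update ![c, d] 0 w = ![w, d] := by
  ext i : 1
  fin_cases i <;> simp

lemma update_one_pair (c d w : ℕ → ℝ) : Function.update ![c, d] 1 w = ![c, w] := by
  ext i : 1
  fin_cases i <;> simp

lemma isProfile_pair {T : ℕ} {c d : ℕ → ℝ} (hc : IsType T c) (hd : IsType T d) :
    IsProfile T ![c, d] := by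
  intro i
  fin_cases i
  exacts [hc, hd]

lemma rev2_eq (T : ℕ) (r x : (Fin 2 → ℕ → ℝ) → Fin 2 → ℕ → ℝ)
    (g : (Fin 2 → ℕ → ℝ) → Fin 2 → ℝ) (v : Fin 2 → ℕ → ℝ) :
    Rev2 T x g v = (∑ t ∈ Finset.Icc 1 T, r v 0 t * v 0 t - utility T r x g v 0)
      + (∑ t ∈ Finset.Icc 1 T, r v 1 t * v 1 t - utility T r x g v 1) := by
  simp only [Rev2, utility, Fin.sum_univ_two, Finset.sum_sub_distrib]
  ring

/-- The revenue guarantee caps the utilities of both bidders. -/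
lemma utility_le {α β : ℝ} (hα : 0 ≤ α) {N M T : ℕ}
    {r x : (Fin 2 → ℕ → ℝ) → Fin 2 → ℕ → ℝ} {g : (Fin 2 → ℕ → ℝ) → Fin 2 → ℝ}
    (h : Truthful2 T r x g) {c d : ℕ → ℝ} (hc : HasMass N M T c) (hd : HasMass N M T d)
    (hrev : Rev2 T x g ![c, d] ≥ α * RevSTB T ![c, d] - β) (i : Fin 2) :
    utility T r x g ![c, d] i ≤ 2 * (N + M) + β := by
  have hv := isProfile_pair hc.1 hd.1
  obtain ⟨h1, h2⟩ := h.1 _ hv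
  have hw : ∀ i, ∑ t ∈ Finset.Icc 1 T, r ![c, d] i t * (![c, d] : Fin 2 → ℕ → ℝ) i t
      ≤ ∑ t ∈ Finset.Icc 1 T, (![c, d] : Fin 2 → ℕ → ℝ) i t := fun i =>
    Finset.sum_le_sum fun t ht =>
      mul_le_of_le_one_left (hv i t ht).1 ((h2 t ht).1 i).1.2
  have hu : ∀ i, 0 ≤ utility T r x g ![c, d] i := fun i =>
    add_nonneg (Finset.sum_nonneg fun t ht => sub_nonneg.2 ((h2 t ht).1 i).2.2) (h1 i)
  have hs : 0 ≤ RevSTB T ![c, d] :=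
    le_min (Finset.sum_nonneg fun t ht => (hv 0 t ht).1)
      (Finset.sum_nonneg fun t ht => (hv 1 t ht).1)
  have hs' := mul_nonneg hα hs
  rw [rev2_eq T r] at hrev
  have w0 := hw 0
  have w1 := hw 1
  have u0 := hu 0
  have u1 := hu 1
  have m0 := hc.2.2
  have m1 := hd.2.2
  simp only [Matrix.cons_val_zero, Matrix.cons_val_one] at w0 w1 hrev
  fin_cases i <;> simp only [Fin.zero_eta, Fin.mk_one] <;> linarith

/-- Averaging over independent random staged types for both bidders bounds the guarantee. -/
lemma guarantee_le {α β : ℝ} (hα : 0 ≤ α) {N M K T : ℕ} (hM : 0 < M) (hK : K ≤ N)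
    (hsum : ∑ k ∈ Finset.range K, 1 / ((N - k : ℕ) : ℝ) ≤ 1)
    (hT : N * N.factorial ^ M ≤ T)
    {r x : (Fin 2 → ℕ → ℝ) → Fin 2 → ℕ → ℝ} {g : (Fin 2 → ℕ → ℝ) → Fin 2 → ℝ}
    (h : Truthful2 T r x g)
    (hrev : ∀ v, IsProfile T v → Rev2 T x g v ≥ α * RevSTB T v - β) :
    M * (α * N - β) ≤ 2 * (M * ((N : ℝ) - K + M + 1) + (2 * (N + M) + β)) := by
  obtain ⟨ι, κ, _, _, p, q, c, d, hp, hp1, hc, hq, hq1, hd, hbound⟩ :=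
    exists_staged_families hK hsum hT (le_refl M)
  replace hd : ∀ j, HasMass N M T (d j) := fun j => by
    obtain ⟨a, ℓ, hj⟩ := hd j
    exact hj.hasMass le_rfl
  set C : ℝ := M * ((N : ℝ) - K + M + 1) + (2 * (N + M) + β) with hC
  set ρ : Fin 2 → ι → ι → ℝ := fun b i j =>
    ∑ t ∈ Finset.Icc 1 T, r ![c i, c j] b t * (![c i, c j] : Fin 2 → ℕ → ℝ) b t
      - utility T r x g ![c i, c j] b with hρ
  have cap : ∀ u : κ → ℝ, (∀ j, u j ≤ 2 * (N + M) + β) →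
      ∑ j, q j * u j ≤ 2 * (N + M) + β := by
    intro u hu
    calc ∑ j, q j * u j ≤ ∑ j, q j * (2 * (N + M) + β) :=
          Finset.sum_le_sum fun j _ => mul_le_mul_of_nonneg_left (hu j) (hq j)
      _ = _ := by rw [← Finset.sum_mul, hq1, one_mul]
  have h0 : ∀ j, ∑ i, p i * ρ 0 i j ≤ C := by
    intro j
    have h1 := hbound _ _ (h.isImitationProof (isProfile_pair (hc j).1 (hc j).1) 0)
    simp only [update_zero_pair, bidderRev] at h1
    have h2 := cap (fun k => utility T r x g ![d k, c j] 0) fun k =>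
      utility_le hα h (hd k) (hc j) (hrev _ (isProfile_pair (hd k).1 (hc j).1)) 0
    simp only [hρ, Matrix.cons_val_zero]
    linarith
  have h1 : ∀ i, ∑ j, p j * ρ 1 i j ≤ C := by
    intro i
    have h1 := hbound _ _ (h.isImitationProof (isProfile_pair (hc i).1 (hc i).1) 1)
    simp only [update_one_pair, bidderRev] at h1
    have h2 := cap (fun k => utility T r x g ![c i, d k] 1) fun k =>
      utility_le hα h (hc i) (hd k) (hrev _ (isProfile_pair (hc i).1 (hd k).1)) 1
    simp only [hρ, Matrix.cons_val_one, Matrix.cons_val_zero]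
    linarith
  have hlow : ∀ i j, α * N - β ≤ ρ 0 i j + ρ 1 i j := by
    intro i j
    have h2 := hrev _ (isProfile_pair (hc i).1 (hc j).1)
    rw [rev2_eq T r] at h2
    have h3 : (N : ℝ) ≤ RevSTB T ![c i, c j] := le_min (hc i).2.1 (hc j).2.1
    have h4 := mul_le_mul_of_nonneg_left h3 hα
    simp only [hρ]
    linarith
  have s0 : ∑ i, ∑ j, p i * p j * ρ 0 i j ≤ M * C := by
    rw [Finset.sum_comm, ← hp1, Finset.sum_mul]
    refine Finset.sum_le_sum fun j _ => ?_
    refine le_trans (le_of_eq ?_) (mul_le_mul_of_nonneg_left (h0 j) (hp j))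
    rw [Finset.mul_sum]
    exact Finset.sum_congr rfl fun i _ => by ring
  have s1 : ∑ i, ∑ j, p i * p j * ρ 1 i j ≤ M * C := by
    rw [← hp1, Finset.sum_mul]
    refine Finset.sum_le_sum fun i _ => ?_
    refine le_trans (le_of_eq ?_) (mul_le_mul_of_nonneg_left (h1 i) (hp i))
    rw [Finset.mul_sum]
    exact Finset.sum_congr rfl fun j _ => by ring
  have s2 : M * (M * (α * N - β))
      ≤ ∑ i, ∑ j, p i * p j * ρ 0 i j + ∑ i, ∑ j, p i * p j * ρ 1 i j := by
    rw [← Finset.sum_add_distrib]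
    nth_rewrite 1 [← hp1]
    rw [Finset.sum_mul]
    refine Finset.sum_le_sum fun i _ => ?_
    rw [← hp1, ← Finset.sum_add_distrib, Finset.sum_mul, Finset.mul_sum]
    refine Finset.sum_le_sum fun j _ => ?_
    have := mul_le_mul_of_nonneg_left (hlow i j) (mul_nonneg (hp i) (hp j))
    linarith
  have hMpos : (0:ℝ) < M := by exact_mod_cast hM
  refine le_of_mul_le_mul_left ?_ hMpos
  linarith

lemma sum_inv_le_log {N K : ℕ} (hK : K < N) :
    ∑ k ∈ Finset.range K, 1 / ((N - k : ℕ) : ℝ) ≤ Real.log (N / (N - K : ℕ)) := by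
  induction K with
  | zero =>
    have : (N : ℝ) ≠ 0 := by exact_mod_cast (by omega : N ≠ 0)
    simp [this]
  | succ K ih =>
    rw [Finset.sum_range_succ]
    have ih := ih (by omega)
    obtain ⟨m, hm⟩ : ∃ m, N - K = m + 1 := ⟨N - K - 1, by omega⟩
    have hm' : N - (K + 1) = m := by omega
    have hm0 : (0:ℝ) < m := by exact_mod_cast (by omega : 0 < m)
    have hN : (0:ℝ) < N := by exact_mod_cast (by omega : 0 < N)
    rw [hm']
    rw [hm] at ih ⊢
    push_cast at ih ⊢
    have h1 := Real.log_le_sub_one_of_pos (x := m / (m + 1)) (by positivity)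
    have h2 : (m : ℝ) / (m + 1) - 1 = -(1 / (m + 1)) := by field_simp; ring
    rw [Real.log_div (by positivity) (by positivity)] at ih h1 ⊢
    linarith

/-- Skipping about `N / e` cells leaves a harmonic sum of at most one. -/
lemma exists_cutoff {N : ℕ} (hN : 0 < N) :
    ∃ K ≤ N, ∑ k ∈ Finset.range K, 1 / ((N - k : ℕ) : ℝ) ≤ 1 ∧
      (N : ℝ) - K ≤ N / Real.exp 1 + 1 := by
  have hNr : (0:ℝ) < N := by exact_mod_cast hN
  have he := Real.exp_pos 1
  have hpos : 0 < (N : ℝ) / Real.exp 1 := by positivity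
  have hJ1 : 0 < ⌈(N : ℝ) / Real.exp 1⌉₊ := Nat.ceil_pos.2 hpos
  have hJN : ⌈(N : ℝ) / Real.exp 1⌉₊ ≤ N :=
    Nat.ceil_le.2 (div_le_self hNr.le (Real.one_le_exp zero_le_one))
  have hlow := Nat.le_ceil ((N : ℝ) / Real.exp 1)
  have hup := (Nat.ceil_lt_add_one hpos.le).le
  set J := ⌈(N : ℝ) / Real.exp 1⌉₊
  have hJr : (0:ℝ) < J := by exact_mod_cast hJ1
  refine ⟨N - J, Nat.sub_le _ _, (sum_inv_le_log (by omega)).trans ?_, ?_⟩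
  · rw [Nat.sub_sub_self hJN, Real.log_le_iff_le_exp (by positivity), div_le_iff₀ hJr]
    rw [div_le_iff₀ he] at hlow
    linarith
  · rw [Nat.cast_sub hJN]
    linarith

/-- For any `α > 2/e` and `β ≥ 0`, for all sufficiently large `T` there is no
truthful two-bidder mechanism over `T` rounds with revenue at least
`α · RevSTB(v) − β` on every type profile `v`. -/
theorem stmt14 (α β : ℝ) (hα : α > 2 / Real.exp 1) (hβ : 0 ≤ β) :
    ∃ T₀ : ℕ, ∀ T : ℕ, T₀ ≤ T →
      ¬ ∃ (r x : (Fin 2 → ℕ → ℝ) → Fin 2 → ℕ → ℝ)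
          (g : (Fin 2 → ℕ → ℝ) → Fin 2 → ℝ), Truthful2 T r x g ∧
        ∀ v, IsProfile T v → Rev2 T x g v ≥ α * RevSTB T v - β := by
  have he := Real.exp_pos 1
  have hα0 : 0 ≤ α := (by positivity : 0 ≤ 2 / Real.exp 1).trans hα.le
  set δ := α - 2 / Real.exp 1 with hδ
  have hδpos : 0 < δ := sub_pos.2 hα
  obtain ⟨M, hM⟩ := exists_nat_gt (8 / δ)
  have hMr : (0:ℝ) < M := (by positivity : 0 < 8 / δ).trans hM
  have hM0 : 0 < M := by exact_mod_cast hMr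
  obtain ⟨N, hN⟩ := exists_nat_gt
    (2 / (M * δ) * (M * β + 2 * M * (M + 2) + 4 * M + 2 * β))
  have hNr : (0:ℝ) < N := lt_of_le_of_lt (by positivity) hN
  obtain ⟨K, hK, hsum, hcut⟩ := exists_cutoff (N := N) (by exact_mod_cast hNr)
  refine ⟨N * N.factorial ^ M, fun T hT => ?_⟩
  rintro ⟨r, x, g, htruth, hrev⟩
  have key := guarantee_le hα0 hM0 hK hsum hT htruth hrev
  have hcut' := mul_le_mul_of_nonneg_left hcut hMr.le
  rw [div_lt_iff₀ hδpos] at hM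
  have hα' : α = δ + 2 / Real.exp 1 := by rw [hδ]; ring
  have h8 := mul_lt_mul_of_pos_left hM hNr
  rw [div_mul_eq_mul_div, div_lt_iff₀ (by positivity)] at hN
  rw [hα'] at key
  have e1 : (M : ℝ) * ((δ + 2 / Real.exp 1) * N - β)
      = M * δ * N + 2 * (M * (N / Real.exp 1)) - M * β := by ring
  rw [e1] at key
  nlinarith
end

section
/- There is an absolute constant C such that for every T ∈ ℕ there exists a truthful two-bidder mechanism over T rounds satisfying Rev(v) ≥ (1/(2e)) · RevSTB(v) − C for all type profiles v. -/
open Finset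

/-- The allocation share offered to a bidder who has already contributed `a` towards the price `P`.
It is half of the ratio of `c` to the outstanding amount, truncated at `1 / 2`. -/
noncomputable def share (c P a : ℝ) : ℝ := c / (2 * max c (P - a))

/-- An upper bound for the gain `share c P a * (V - a)` of a bidder of total value `V`
who contributes only `a`. -/
noncomputable def maxGain (c P V : ℝ) : ℝ :=
  if P ≤ V then (V - P + c) / 2 else c * V / (2 * P)

lemma share_pos {c : ℝ} (hc : 0 < c) (P a : ℝ) : 0 < share c P a := by
  have : 0 < max c (P - a) := lt_max_of_lt_left hc
  unfold share
  positivity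

lemma share_le_half {c : ℝ} (hc : 0 < c) (P a : ℝ) : share c P a ≤ 1 / 2 := by
  have h : 0 < max c (P - a) := lt_max_of_lt_left hc
  unfold share
  rw [div_le_div_iff₀ (by positivity) (by norm_num)]
  linarith [le_max_left c (P - a)]

lemma share_mono {c : ℝ} (hc : 0 < c) (P : ℝ) : Monotone (share c P) := by
  intro a b hab
  have h : 0 < max c (P - b) := lt_max_of_lt_left hc
  unfold share
  gcongr

lemma maxGain_nonneg {c P V : ℝ} (hc : 0 < c) (hP : 0 < P) (hV : 0 ≤ V) :
    0 ≤ maxGain c P V := by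
  unfold maxGain
  split_ifs
  · linarith
  · positivity

lemma share_mul_le_maxGain {c P V a : ℝ} (hc : 0 < c) (hP : 0 < P) (ha : 0 ≤ a) (haV : a ≤ V) :
    share c P a * (V - a) ≤ maxGain c P V := by
  have h : 0 < max c (P - a) := lt_max_of_lt_left hc
  have h1 := le_max_left c (P - a)
  have h2 := le_max_right c (P - a)
  unfold share maxGain
  rw [div_mul_eq_mul_div, div_le_iff₀ (by positivity)]
  split_ifs with hPV
  · nlinarith [mul_nonneg (sub_nonneg.2 hPV) (sub_nonneg.2 h1),
      mul_nonneg hc.le (sub_nonneg.2 h2)]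
  · have hPV' : V ≤ P := (not_le.1 hPV).le
    rw [div_mul_eq_mul_div, le_div_iff₀ (by positivity)]
    have hm : (V - a) * P ≤ V * max c (P - a) := by
      nlinarith [mul_nonneg ha (sub_nonneg.2 hPV'),
        mul_nonneg (ha.trans haV) (sub_nonneg.2 h2)]
    nlinarith [mul_le_mul_of_nonneg_left hm hc.le]

/-- The discrete form of the fact that the potential on the right is a primitive of
twice the share. -/
lemma potential_le_share_mul {c P a b : ℝ} (hc : 0 < c) (hab : a ≤ b) :
    (c * (Real.log (max c (P - a)) - Real.log (max c (P - b))) + (b - a)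
      + (max c (P - b) - max c (P - a))) / 2 ≤ share c P b * (b - a) := by
  have ha : 0 < max c (P - a) := lt_max_of_lt_left hc
  have hb : 0 < max c (P - b) := lt_max_of_lt_left hc
  have hlog := Real.log_le_sub_one_of_pos (div_pos ha hb)
  rw [Real.log_div ha.ne' hb.ne'] at hlog
  have hlog' := mul_le_mul_of_nonneg_left hlog hc.le
  have key : c * (max c (P - a) / max c (P - b) - 1) + (b - a)
      + (max c (P - b) - max c (P - a)) ≤ c / max c (P - b) * (b - a) := by
    rcases le_total c (P - b) with h | h
    · have h' : c ≤ P - a := by linarith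
      rw [max_eq_right h] at hb
      rw [max_eq_right h, max_eq_right h']
      apply le_of_eq
      field_simp
      ring
    · rw [max_eq_left h]
      apply le_of_eq
      field_simp
      ring
  have hs : share c P b * (b - a) = c / max c (P - b) * (b - a) / 2 := by
    unfold share
    field_simp
  rw [hs]
  linarith

lemma sum_Icc_nonneg_of_le {T n : ℕ} (hn : n ≤ T) {w : ℕ → ℝ} (hw : ∀ t ∈ Icc 1 T, 0 ≤ w t) :
    0 ≤ ∑ s ∈ Icc 1 n, w s :=
  sum_nonneg fun t ht => hw t (Icc_subset_Icc_right hn ht)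

lemma sum_Icc_mono {T n : ℕ} (hn : n ≤ T) {w : ℕ → ℝ} (hw : ∀ t ∈ Icc 1 T, 0 ≤ w t) :
    ∑ s ∈ Icc 1 n, w s ≤ ∑ s ∈ Icc 1 T, w s :=
  sum_le_sum_of_subset_of_nonneg (Icc_subset_Icc_right hn) fun t ht _ => hw t ht

lemma potential_le_sum_share {c P : ℝ} (hc : 0 < c) {w : ℕ → ℝ} (n : ℕ)
    (hw : ∀ t ∈ Icc 1 n, 0 ≤ w t) :
    (c * (Real.log (max c P) - Real.log (max c (P - ∑ s ∈ Icc 1 n, w s))) + ∑ s ∈ Icc 1 n, w s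
      + (max c (P - ∑ s ∈ Icc 1 n, w s) - max c P)) / 2
      ≤ ∑ t ∈ Icc 1 n, share c P (∑ s ∈ Icc 1 t, w s) * w t := by
  induction n with
  | zero => simp
  | succ n ih =>
    have ih' := ih fun t ht => hw t (Icc_subset_Icc_right n.le_succ ht)
    have hstep := potential_le_share_mul (P := P) hc
      (sum_Icc_mono n.le_succ hw)
    have hsum : ∑ s ∈ Icc 1 (n + 1), w s = ∑ s ∈ Icc 1 n, w s + w (n + 1) :=
      sum_Icc_succ_top (by omega) _
    rw [sum_Icc_succ_top (by omega : 1 ≤ n + 1)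
      (fun t => share c P (∑ s ∈ Icc 1 t, w s) * w t)]
    have hd : ∑ s ∈ Icc 1 (n + 1), w s - ∑ s ∈ Icc 1 n, w s = w (n + 1) := by
      rw [hsum]; ring
    rw [Nat.succ_eq_add_one, hd] at hstep
    linarith

lemma share_zero_mul_le_sum_share {c P : ℝ} (hc : 0 < c) {w : ℕ → ℝ} {T : ℕ}
    (hw : ∀ t ∈ Icc 1 T, 0 ≤ w t) :
    share c P 0 * ∑ t ∈ Icc 1 T, w t ≤ ∑ t ∈ Icc 1 T, share c P (∑ s ∈ Icc 1 t, w s) * w t := by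
  rw [mul_sum]
  refine sum_le_sum fun t ht => mul_le_mul_of_nonneg_right (share_mono hc P ?_) (hw t ht)
  exact sum_Icc_nonneg_of_le (mem_Icc.1 ht).2 hw

/-- The payments of a bidder whose total value reaches the price exceed `maxGain` by `c / 2`. -/
lemma half_add_maxGain_le_sum_share {c P : ℝ} (hc : 0 < c) (hP : Real.exp 1 * c = P) {w : ℕ → ℝ} {T : ℕ}
    (hw : ∀ t ∈ Icc 1 T, 0 ≤ w t) (hPw : P ≤ ∑ t ∈ Icc 1 T, w t) :
    c / 2 + maxGain c P (∑ t ∈ Icc 1 T, w t)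
      ≤ ∑ t ∈ Icc 1 T, share c P (∑ s ∈ Icc 1 t, w s) * w t := by
  have hcP : c ≤ P := by nlinarith [Real.add_one_le_exp (1 : ℝ)]
  have h := potential_le_sum_share (P := P) hc T hw
  rw [max_eq_right hcP, max_eq_left (by linarith : P - ∑ t ∈ Icc 1 T, w t ≤ c), ← hP,
    Real.log_mul (Real.exp_pos 1).ne' hc.ne', Real.log_exp, hP] at h
  rw [maxGain, if_pos hPw]
  linarith

lemma maxGain_le_sum_share {c P : ℝ} (hc : 0 < c) (hP : Real.exp 1 * c = P)
    {w : ℕ → ℝ} {T : ℕ} (hw : ∀ t ∈ Icc 1 T, 0 ≤ w t) :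
    maxGain c P (∑ t ∈ Icc 1 T, w t)
      ≤ ∑ t ∈ Icc 1 T, share c P (∑ s ∈ Icc 1 t, w s) * w t := by
  by_cases hPw : P ≤ ∑ t ∈ Icc 1 T, w t
  · linarith [half_add_maxGain_le_sum_share hc hP hw hPw]
  · have hcP : c ≤ P := by nlinarith [Real.add_one_le_exp (1 : ℝ)]
    refine le_trans (le_of_eq ?_) (share_zero_mul_le_sum_share hc hw)
    rw [maxGain, if_neg hPw, share, sub_zero, max_eq_right hcP]
    ring

/-- Underreporting as `w` and defaulting in round `τ` gains at most `maxGain + 1 / 2`. -/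
lemma default_gain_le {c P : ℝ} (hc : 0 < c) (hP : 0 < P) {u w : ℕ → ℝ} {T τ : ℕ}
    (hτ : τ ∈ Icc 1 T) (hu : ∀ t ∈ Icc 1 T, 0 ≤ u t) (hw : ∀ t ∈ Icc 1 T, w t ∈ Set.Icc (0 : ℝ) 1)
    (hwu : ∀ t ∈ Icc 1 τ, w t ≤ u t) :
    (∑ t ∈ Icc 1 τ, (share c P (∑ s ∈ Icc 1 t, w s) * u t
        - share c P (∑ s ∈ Icc 1 t, w s) * w t))
      + share c P (∑ s ∈ Icc 1 τ, w s) * w τ ≤ maxGain c P (∑ t ∈ Icc 1 T, u t) + 1 / 2 := by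
  have hτT : τ ≤ T := (mem_Icc.1 hτ).2
  have hw0 : ∀ t ∈ Icc 1 τ, 0 ≤ w t := fun t ht => (hw t (Icc_subset_Icc_right hτT ht)).1
  have hpos := share_pos hc P (∑ s ∈ Icc 1 τ, w s)
  have hlast : share c P (∑ s ∈ Icc 1 τ, w s) * w τ ≤ 1 / 2 := by
    nlinarith [share_le_half hc P (∑ s ∈ Icc 1 τ, w s), (hw τ hτ).1, (hw τ hτ).2]
  have hWV : ∑ s ∈ Icc 1 τ, w s ≤ ∑ s ∈ Icc 1 τ, u s := sum_le_sum hwu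
  have hVT := sum_Icc_mono hτT hu
  have hmain : ∑ t ∈ Icc 1 τ, (share c P (∑ s ∈ Icc 1 t, w s) * u t
        - share c P (∑ s ∈ Icc 1 t, w s) * w t)
      ≤ share c P (∑ s ∈ Icc 1 τ, w s) * (∑ s ∈ Icc 1 τ, u s - ∑ s ∈ Icc 1 τ, w s) := by
    rw [← sum_sub_distrib, mul_sum]
    refine sum_le_sum fun t ht => ?_
    rw [← mul_sub]
    exact mul_le_mul_of_nonneg_right
      (share_mono hc P (sum_Icc_mono (mem_Icc.1 ht).2 hw0)) (sub_nonneg.2 (hwu t ht))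
  have hgain := share_mul_le_maxGain hc hP (sum_nonneg hw0) (hWV.trans hVT)
  have := mul_le_mul_of_nonneg_left (sub_le_sub_right hVT (∑ s ∈ Icc 1 τ, w s)) hpos.le
  linarith

/-- The price offered to bidder `i`: the total value of the other bidder, but at least `1`. -/
noncomputable def price (T : ℕ) (v : Fin 2 → ℕ → ℝ) (i : Fin 2) : ℝ :=
  max 1 (∑ t ∈ Icc 1 T, v (i + 1) t)

/-- The allocation of the mechanism attaining `1 / (2e)` of the benchmark. -/
noncomputable def alloc (T : ℕ) (v : Fin 2 → ℕ → ℝ) (i : Fin 2) (t : ℕ) : ℝ :=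
  share (price T v i / Real.exp 1) (price T v i) (∑ s ∈ Icc 1 t, v i s)

/-- The reimbursement of the mechanism attaining `1 / (2e)` of the benchmark. -/
noncomputable def reimb (T : ℕ) (v : Fin 2 → ℕ → ℝ) (i : Fin 2) : ℝ :=
  maxGain (price T v i / Real.exp 1) (price T v i) (∑ t ∈ Icc 1 T, v i t) + 1 / 2

lemma price_pos (T : ℕ) (v : Fin 2 → ℕ → ℝ) (i : Fin 2) : 0 < price T v i :=
  lt_max_of_lt_left one_pos

lemma price_div_exp_pos (T : ℕ) (v : Fin 2 → ℕ → ℝ) (i : Fin 2) :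
    0 < price T v i / Real.exp 1 :=
  div_pos (price_pos T v i) (Real.exp_pos 1)

lemma price_update (T : ℕ) (v : Fin 2 → ℕ → ℝ) (i : Fin 2) (w : ℕ → ℝ) :
    price T (Function.update v i w) i = price T v i := by
  have h : ∀ i : Fin 2, i + 1 ≠ i := by decide
  simp only [price, Function.update_of_ne (h i)]

lemma truthful2_alloc (T : ℕ) :
    Truthful2 T (alloc T) (fun v i t => alloc T v i t * v i t) (reimb T) := by
  refine ⟨fun v hv => ⟨fun i => ?_, fun t ht => ⟨fun i => ⟨⟨?_, ?_⟩, ?_, le_rfl⟩, ?_⟩⟩, ?_⟩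
  · have := maxGain_nonneg (price_div_exp_pos T v i) (price_pos T v i)
      (sum_nonneg fun t ht => (hv i t ht).1)
    unfold reimb
    linarith
  · exact (share_pos (price_div_exp_pos T v i) _ _).le
  · have : alloc T v i t ≤ 1 / 2 := share_le_half (price_div_exp_pos T v i) _ _
    linarith
  · exact mul_nonneg (share_pos (price_div_exp_pos T v i) _ _).le (hv i t ht).1
  · have h (i) : alloc T v i t ≤ 1 / 2 := share_le_half (price_div_exp_pos T v i) _ _
    linarith [h 0, h 1]
  · intro v hv i w hw τ hτ hpay
    have hw' : ∀ t ∈ Icc 1 T, w t ∈ Set.Icc (0 : ℝ) 1 := by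
      simpa using hw i
    have hc := price_div_exp_pos T v i
    simp only [alloc, price_update, Function.update_self] at hpay ⊢
    have hwu : ∀ t ∈ Icc 1 τ, w t ≤ v i t := fun t ht =>
      le_of_mul_le_mul_left (hpay t ht) (share_pos hc _ _)
    simpa [reimb] using
      default_gain_le hc (price_pos T v i) hτ (fun t ht => (hv i t ht).1) hw' hwu

lemma neg_half_le_net_payment {T : ℕ} {v : Fin 2 → ℕ → ℝ} (hv : IsProfile T v) (i : Fin 2) :
    -(1 / 2) ≤ ∑ t ∈ Icc 1 T, alloc T v i t * v i t - reimb T v i := by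
  have := maxGain_le_sum_share (price_div_exp_pos T v i)
    (mul_div_cancel₀ _ (Real.exp_pos 1).ne') fun t ht => (hv i t ht).1
  unfold alloc reimb
  linarith

lemma le_net_payment {T : ℕ} {v : Fin 2 → ℕ → ℝ} (hv : IsProfile T v) (i : Fin 2)
    (h : ∑ t ∈ Icc 1 T, v (i + 1) t ≤ ∑ t ∈ Icc 1 T, v i t) :
    1 / (2 * Real.exp 1) * ∑ t ∈ Icc 1 T, v (i + 1) t - 1
      ≤ ∑ t ∈ Icc 1 T, alloc T v i t * v i t - reimb T v i := by
  have he := Real.add_one_le_exp (1 : ℝ)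
  have hcoef : 1 / (2 * Real.exp 1) ≤ 1 / 2 := by gcongr; linarith
  have hcoef0 : 0 < 1 / (2 * Real.exp 1) := by positivity
  by_cases h1 : 1 ≤ ∑ t ∈ Icc 1 T, v i t
  · have := half_add_maxGain_le_sum_share (price_div_exp_pos T v i)
      (mul_div_cancel₀ _ (Real.exp_pos 1).ne') (fun t ht => (hv i t ht).1) (max_le h1 h)
    have hp := mul_le_mul_of_nonneg_left
      (le_max_right 1 (∑ t ∈ Icc 1 T, v (i + 1) t)) hcoef0.le
    have heq : 1 / (2 * Real.exp 1) * max 1 (∑ t ∈ Icc 1 T, v (i + 1) t)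
        = price T v i / Real.exp 1 / 2 := by
      unfold price
      field_simp
    unfold alloc reimb
    linarith
  · have := neg_half_le_net_payment hv i
    have h0 : 0 ≤ ∑ t ∈ Icc 1 T, v (i + 1) t := sum_nonneg fun t ht => (hv _ t ht).1
    nlinarith

/-- There is an absolute constant `C` such that for every `T` some truthful
two-bidder mechanism over `T` rounds attains revenue at least
`(1/(2e)) · RevSTB(v) − C` on every type profile `v`. -/
theorem stmt16 :
    ∃ C : ℝ, ∀ T : ℕ,
      ∃ (r x : (Fin 2 → ℕ → ℝ) → Fin 2 → ℕ → ℝ)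
        (g : (Fin 2 → ℕ → ℝ) → Fin 2 → ℝ), Truthful2 T r x g ∧
        ∀ v, IsProfile T v →
          Rev2 T x g v ≥ (1 / (2 * Real.exp 1)) * RevSTB T v - C := by
  refine ⟨2, fun T => ⟨alloc T, fun v i t => alloc T v i t * v i t, reimb T,
    truthful2_alloc T, fun v hv => ?_⟩⟩
  have n0 := neg_half_le_net_payment hv 0
  have n1 := neg_half_le_net_payment hv 1
  simp only [Rev2, RevSTB, Fin.sum_univ_two]
  rcases le_total (∑ t ∈ Icc 1 T, v 0 t) (∑ t ∈ Icc 1 T, v 1 t) with h | h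
  · have := le_net_payment hv 1 h
    rw [min_eq_left h]
    change 1 / (2 * Real.exp 1) * ∑ t ∈ Icc 1 T, v 0 t - 1 ≤ _ at this
    linarith
  · have := le_net_payment hv 0 h
    rw [min_eq_right h]
    change 1 / (2 * Real.exp 1) * ∑ t ∈ Icc 1 T, v 1 t - 1 ≤ _ at this
    linarith
end
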